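/- There exists a sequence (P_k)_{k≥1}, where each P_k ∈ ℝ[x₀,x₁,x₂] is a nonzero homogeneous polynomial of degree 2k, squarefree over ℂ, with ℝZ(P_k) finite, such that the sequence |ℝZ(P_k)|/k² tends to 4/3 as k → ∞. -/

import Mathlib

open MvPolynomial Filter

/-- The real projective zero set of a homogeneous polynomial in three variables. -/
noncomputable def RZ (P : MvPolynomial (Fin 3) ℝ) : Set (Projectivization ℝ (Fin 3 → ℝ)) :=
  {x | MvPolynomial.eval x.rep P = 0}

/-- The substitution `X i ↦ t * X i`. -/
noncomputable def psiHom {σ R : Type*} [CommRing R] :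
    MvPolynomial σ R →ₐ[R] Polynomial (MvPolynomial σ R) :=
  aeval (fun i => (Polynomial.X : Polynomial (MvPolynomial σ R)) * Polynomial.C (X i))

lemma psiHom_monomial {σ R : Type*} [CommRing R] (d : σ →₀ ℕ) (r : R) :
    psiHom (monomial d r) = Polynomial.monomial d.degree (monomial d r) := by
  classical
  unfold psiHom
  rw [aeval_monomial, monomial_eq]
  simp only [Finsupp.prod, mul_pow, Finset.prod_mul_distrib, Finset.prod_pow_eq_pow_sum]
  rw [← Polynomial.C_mul_X_pow_eq_monomial, Finsupp.degree_apply]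
  simp only [map_mul, map_prod, map_pow]
  have : (algebraMap R (Polynomial (MvPolynomial σ R))) r = Polynomial.C (C r) := rfl
  rw [this]; ring

lemma psiHom_coeff {σ R : Type*} [CommRing R] (A : MvPolynomial σ R) (n : ℕ) :
    (psiHom A).coeff n = homogeneousComponent n A := by
  classical
  induction A using MvPolynomial.induction_on' with
  | monomial d r =>
    rw [psiHom_monomial, Polynomial.coeff_monomial]
    rw [homogeneousComponent_of_mem (n := d.degree)
      ((mem_homogeneousSubmodule _ _).2 (isHomogeneous_monomial r rfl))]
    simp only [eq_comm]
  | add p q hp hq => simp [hp, hq]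

lemma psiHom_of_homog {σ R : Type*} [CommRing R] {A : MvPolynomial σ R} {n : ℕ}
    (h : A.IsHomogeneous n) : psiHom A = Polynomial.monomial n A := by
  ext1 m
  rw [psiHom_coeff, Polynomial.coeff_monomial,
    homogeneousComponent_of_mem ((mem_homogeneousSubmodule _ _).2 h)]
  simp only [eq_comm]

lemma psiHom_ne {σ : Type*} (C : MvPolynomial σ ℂ) (hC : C ≠ 0) : psiHom C ≠ 0 := by
  intro h
  apply hC
  rw [← sum_homogeneousComponent C]
  apply Finset.sum_eq_zero
  intro i _
  rw [← psiHom_coeff, h, Polynomial.coeff_zero]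

lemma homog_of_dvd {σ : Type*} {A H : MvPolynomial σ ℂ} {n : ℕ}
    (hH : H.IsHomogeneous n) (h0 : H ≠ 0) (hd : A ∣ H) : ∃ e, A.IsHomogeneous e := by
  obtain ⟨B, rfl⟩ := hd
  have hA : A ≠ 0 := left_ne_zero_of_mul h0
  have hB : B ≠ 0 := right_ne_zero_of_mul h0
  have e1 := psiHom_of_homog hH
  rw [map_mul] at e1
  have d1 : (psiHom A).natDegree + (psiHom B).natDegree = n := by
    rw [← Polynomial.natDegree_mul (psiHom_ne _ hA) (psiHom_ne _ hB), e1]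
    exact Polynomial.natDegree_monomial_eq _ h0
  have d2 : (psiHom A).natTrailingDegree + (psiHom B).natTrailingDegree = n := by
    rw [← Polynomial.natTrailingDegree_mul (psiHom_ne _ hA) (psiHom_ne _ hB), e1]
    exact Polynomial.natTrailingDegree_monomial h0
  have i1 := Polynomial.natTrailingDegree_le_natDegree (psiHom A)
  have i2 := Polynomial.natTrailingDegree_le_natDegree (psiHom B)
  have e : (psiHom A).natDegree = (psiHom A).natTrailingDegree := by omega
  refine ⟨(psiHom A).natDegree, ?_⟩
  have : A = homogeneousComponent (psiHom A).natDegree A := by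
    conv_lhs => rw [← sum_homogeneousComponent A]
    by_cases hd : (psiHom A).natDegree ∈ Finset.range (A.totalDegree + 1)
    · rw [Finset.sum_eq_single_of_mem _ hd]
      intro b _ hb
      rw [← psiHom_coeff]
      rcases lt_or_gt_of_ne hb with h | h
      · exact Polynomial.coeff_eq_zero_of_lt_natTrailingDegree (by omega)
      · exact Polynomial.coeff_eq_zero_of_natDegree_lt h
    · exfalso
      have := homogeneousComponent_eq_zero (psiHom A).natDegree A
        (by simp at hd; omega)
      rw [← psiHom_coeff] at this
      exact psiHom_ne _ hA (Polynomial.leadingCoeff_eq_zero.1 this)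
  have h := homogeneousComponent_isHomogeneous (psiHom A).natDegree A
  rwa [← this] at h

lemma sqfree_aux (K : ℕ) :
    Squarefree (∏ j ∈ Finset.range K, ((Polynomial.X : Polynomial ℂ) ^ 2 + Polynomial.C ((j : ℂ) + 1))) := by
  refine Polynomial.Separable.squarefree (Polynomial.separable_prod' ?_ ?_)
  · intro i _ j _ hij
    refine ⟨Polynomial.C ((i:ℂ) - j)⁻¹, - Polynomial.C ((i:ℂ) - j)⁻¹, ?_⟩
    have : (i:ℂ) - j ≠ 0 := sub_ne_zero.2 (by exact_mod_cast hij)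
    have e : Polynomial.C ((i:ℂ) - j)⁻¹ * Polynomial.C ((i:ℂ) - j) = 1 := by
      rw [← Polynomial.C_mul, inv_mul_cancel₀ this, Polynomial.C_1]
    rw [← e]
    simp only [Polynomial.C_add, Polynomial.C_sub]
    ring
  · intro i _
    have h2 : ((2 : ℕ) : ℂ) ≠ 0 := by norm_num
    have h3 : -((i:ℂ) + 1) ≠ 0 := neg_ne_zero.2 (Nat.cast_add_one_ne_zero i)
    have h4 : (Polynomial.X : Polynomial ℂ) ^ 2 + Polynomial.C ((i : ℂ) + 1) =
      Polynomial.X ^ 2 - Polynomial.C (-((i:ℂ) + 1)) := by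
      rw [Polynomial.C_neg, sub_neg_eq_add]
    rw [h4]
    exact Polynomial.separable_X_pow_sub_C (-((i:ℂ) + 1)) h2 h3

/-- The definite top-degree form. -/
noncomputable def Eform (K : ℕ) : MvPolynomial (Fin 3) ℝ :=
  ∏ j ∈ Finset.range K, ((X 1) ^ 2 + C ((j : ℝ) + 1) * (X 2) ^ 2)

lemma Eform_homog (K : ℕ) : (Eform K).IsHomogeneous (2 * K) := by
  have := IsHomogeneous.prod (Finset.range K)
    (fun j : ℕ => ((X 1) ^ 2 + C ((j : ℝ) + 1) * (X 2) ^ 2 : MvPolynomial (Fin 3) ℝ)) (fun _ => 2)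
    (fun j _ => by
      refine IsHomogeneous.add (isHomogeneous_X_pow _ _) ?_
      exact isHomogeneous_C_mul_X_pow _ _ _)
  simpa [Eform, mul_comm] using this

lemma sqfree_main (K : ℕ) (H0 : MvPolynomial (Fin 3) ℝ) (s : ℝ) (hs : 0 < s)
    (hh : (X 0 * H0 + C s * Eform K).IsHomogeneous (2 * K)) :
    Squarefree (MvPolynomial.map (algebraMap ℝ ℂ) (X 0 * H0 + C s * Eform K)) := by
  set H := MvPolynomial.map (algebraMap ℝ ℂ) (X 0 * H0 + C s * Eform K) with hHdef
  have hH : H.IsHomogeneous (2 * K) := hh.map _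
  have ev : ∀ x y : ℂ, eval ![0, x, y] H =
      s * ∏ j ∈ Finset.range K, (x ^ 2 + ((j:ℂ) + 1) * y ^ 2) := by
    intro x y
    simp [hHdef, Eform, map_prod]
  have evX : aeval ![0, Polynomial.X, 1] H =
      Polynomial.C (s:ℂ) * ∏ j ∈ Finset.range K, ((Polynomial.X : Polynomial ℂ) ^ 2 + Polynomial.C ((j : ℂ) + 1)) := by
    apply Polynomial.funext
    intro x
    have : ∀ A : MvPolynomial (Fin 3) ℂ, Polynomial.eval x (aeval ![0, Polynomial.X, 1] A)
      = eval ![0, x, 1] A := by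
      intro A
      induction A using MvPolynomial.induction_on with
      | C a => simp
      | add p q hp hq => simp [hp, hq]
      | mul_X p i hp =>
        simp only [map_mul, aeval_X, Polynomial.eval_mul, hp, eval_X]
        fin_cases i <;> simp
    rw [this, ev]
    simp [Polynomial.eval_prod]
  have sne : (s:ℂ) ≠ 0 := by exact_mod_cast hs.ne'
  have h0 : H ≠ 0 := by
    intro h
    have := ev 1 0
    rw [h] at this
    simp at this
    exact sne this.symm
  intro A hA
  have hAd : A ∣ H := dvd_trans (Dvd.intro _ rfl) hA
  obtain ⟨e, he⟩ := homog_of_dvd hH h0 hAd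
  have hA0 : A ≠ 0 := by
    rintro rfl
    simp at hA
    exact h0 hA
  have e0 : e = 0 := by
    by_contra hne
    -- the restriction is a unit
    have u : IsUnit (aeval ![0, (Polynomial.X : Polynomial ℂ), 1] A) := by
      have h1 : aeval ![0, (Polynomial.X : Polynomial ℂ), 1] A * aeval ![0, (Polynomial.X : Polynomial ℂ), 1] A ∣
        ∏ j ∈ Finset.range K, ((Polynomial.X : Polynomial ℂ) ^ 2 + Polynomial.C ((j : ℂ) + 1)) := by
        have := map_dvd (aeval ![0, (Polynomial.X : Polynomial ℂ), 1]) hA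
        rw [map_mul, evX] at this
        have uc : IsUnit (Polynomial.C (s:ℂ)) := Polynomial.isUnit_C.2 (isUnit_iff_ne_zero.2 sne)
        exact (uc.dvd_mul_left).1 this
      exact sqfree_aux K _ h1
    obtain ⟨c, hc, hcA⟩ := Polynomial.isUnit_iff.1 u
    have evA : ∀ x : ℂ, eval ![0, x, 1] A = c := by
      intro x
      have : ∀ A : MvPolynomial (Fin 3) ℂ, Polynomial.eval x (aeval ![0, Polynomial.X, 1] A)
        = eval ![0, x, 1] A := by
        intro A
        induction A using MvPolynomial.induction_on with
        | C a => simp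
        | add p q hp hq => simp [hp, hq]
        | mul_X p i hp =>
          simp only [map_mul, aeval_X, Polynomial.eval_mul, hp, eval_X]
          fin_cases i <;> simp
      rw [← this, ← hcA]; simp
    -- A(0,1,y) = c y^e
    have ev2 : ∀ y : ℂ, y ≠ 0 → eval ![0, 1, y] A = c * y ^ e := by
      intro y hy
      have hv : (![0, 1, y] : Fin 3 → ℂ) = y • ![0, y⁻¹, 1] := by
        ext i; fin_cases i <;> simp [hy]
      have key : eval (y • ![0, y⁻¹, 1]) A = y ^ e * eval ![0, y⁻¹, 1] A := by
        rw [eval_eq, eval_eq, Finset.mul_sum]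
        apply Finset.sum_congr rfl
        intro d hd
        have hdeg := he.degree_eq_sum_deg_support hd
        simp only [Pi.smul_apply, smul_eq_mul, mul_pow, Finset.prod_mul_distrib,
          Finset.prod_pow_eq_pow_sum]
        rw [hdeg]
        ring
      rw [hv, key, evA]; ring
    have hpoly : aeval ![0, 1, (Polynomial.X : Polynomial ℂ)] A = Polynomial.C c * Polynomial.X ^ e := by
      apply Polynomial.eq_of_infinite_eval_eq
      have inf : Set.Infinite ({0}ᶜ : Set ℂ) := Set.Finite.infinite_compl (Set.finite_singleton _)
      refine inf.mono ?_
      intro y hy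
      have : ∀ A : MvPolynomial (Fin 3) ℂ, Polynomial.eval y (aeval ![0, 1, Polynomial.X] A)
        = eval ![0, 1, y] A := by
        intro A
        induction A using MvPolynomial.induction_on with
        | C a => simp
        | add p q hp hq => simp [hp, hq]
        | mul_X p i hp =>
          simp only [map_mul, aeval_X, Polynomial.eval_mul, hp, eval_X]
          fin_cases i <;> simp
      simp only [Set.mem_ofPred_eq]
      rw [this, ev2 y hy]; simp
    have hz : eval ![0, 1, 0] A = 0 := by
      have : ∀ A : MvPolynomial (Fin 3) ℂ, Polynomial.eval 0 (aeval ![0, 1, Polynomial.X] A)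
        = eval ![0, 1, 0] A := by
        intro A
        induction A using MvPolynomial.induction_on with
        | C a => simp
        | add p q hp hq => simp [hp, hq]
        | mul_X p i hp =>
          simp only [map_mul, aeval_X, Polynomial.eval_mul, hp, eval_X]
          fin_cases i <;> simp
      rw [← this, hpoly]; simp [hne]
    obtain ⟨B, hB⟩ := hAd
    have := ev 1 0
    rw [hB, map_mul, hz] at this
    simp at this
    exact sne this.symm
  subst e0
  have := totalDegree_eq_zero_iff_eq_C.1 (Nat.le_zero.1 he.totalDegree_le)
  rw [this]
  rw [this] at hA0
  have : coeff 0 A ≠ 0 := by intro h; rw [h] at hA0; simp at hA0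
  exact (isUnit_iff_ne_zero.2 this).map C


/-- `f` is a real polynomial function of degree at most `d` on `ℂ = ℝ²`. -/
def PF (d : ℕ) (f : ℂ → ℝ) : Prop :=
  ∃ H : MvPolynomial (Fin 3) ℝ, H.IsHomogeneous d ∧ ∀ z : ℂ, eval ![1, z.re, z.im] H = f z

lemma PF.mono {d e : ℕ} {f : ℂ → ℝ} (h : PF d f) (hde : d ≤ e) : PF e f := by
  obtain ⟨H, h1, h2⟩ := h
  refine ⟨X 0 ^ (e - d) * H, ?_, ?_⟩
  · have := (isHomogeneous_X_pow (R := ℝ) (0 : Fin 3) (e - d)).mul h1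
    rwa [Nat.sub_add_cancel hde] at this
  · intro z; simp [h2]

lemma PF.add {d : ℕ} {f g : ℂ → ℝ} (hf : PF d f) (hg : PF d g) : PF d (fun z => f z + g z) := by
  obtain ⟨H, h1, h2⟩ := hf
  obtain ⟨G, g1, g2⟩ := hg
  exact ⟨H + G, h1.add g1, fun z => by simp [h2, g2]⟩

lemma PF.mul {d e : ℕ} {f g : ℂ → ℝ} (hf : PF d f) (hg : PF e g) :
    PF (d + e) (fun z => f z * g z) := by
  obtain ⟨H, h1, h2⟩ := hf
  obtain ⟨G, g1, g2⟩ := hg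
  exact ⟨H * G, h1.mul g1, fun z => by simp [h2, g2]⟩

lemma PF.const (d : ℕ) (c : ℝ) : PF d (fun _ => c) :=
  PF.mono (d := 0) ⟨C c, isHomogeneous_C _ _, fun z => by simp⟩ (Nat.zero_le _)

lemma PF.re : PF 1 (fun z => z.re) := ⟨X 1, isHomogeneous_X _ _, fun z => by simp⟩
lemma PF.im : PF 1 (fun z => z.im) := ⟨X 2, isHomogeneous_X _ _, fun z => by simp⟩

lemma PF.smul {d : ℕ} {f : ℂ → ℝ} (c : ℝ) (hf : PF d f) : PF d (fun z => c * f z) := by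
  have := (PF.const 0 c).mul hf
  rwa [zero_add] at this

lemma PF.neg {d : ℕ} {f : ℂ → ℝ} (hf : PF d f) : PF d (fun z => - f z) := by
  have := hf.smul (-1)
  simpa using this

lemma PF.sub {d : ℕ} {f g : ℂ → ℝ} (hf : PF d f) (hg : PF d g) : PF d (fun z => f z - g z) := by
  have := hf.add hg.neg
  simpa [sub_eq_add_neg] using this

lemma PF.sum {d : ℕ} {ι : Type*} (s : Finset ι) {f : ι → ℂ → ℝ} (hf : ∀ i ∈ s, PF d (f i)) :
    PF d (fun z => ∑ i ∈ s, f i z) := by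
  classical
  induction s using Finset.induction_on with
  | empty => simpa using PF.const d 0
  | insert a s ha ih =>
    simp only [Finset.sum_insert ha]
    exact (hf a (by simp)).add (ih fun i hi => hf i (by simp [hi]))

lemma PF.pow {d : ℕ} {f : ℂ → ℝ} (hf : PF d f) (n : ℕ) : PF (d * n) (fun z => f z ^ n) := by
  obtain ⟨H, h1, h2⟩ := hf
  exact ⟨H ^ n, h1.pow n, fun z => by simp [h2]⟩

/-- Complex version. -/
def CPF (d : ℕ) (f : ℂ → ℂ) : Prop := PF d (fun z => (f z).re) ∧ PF d (fun z => (f z).im)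

lemma CPF.mono {d e : ℕ} {f : ℂ → ℂ} (h : CPF d f) (hde : d ≤ e) : CPF e f :=
  ⟨h.1.mono hde, h.2.mono hde⟩

lemma CPF.add {d : ℕ} {f g : ℂ → ℂ} (hf : CPF d f) (hg : CPF d g) : CPF d (fun z => f z + g z) :=
  ⟨by simpa using hf.1.add hg.1, by simpa using hf.2.add hg.2⟩

lemma CPF.sub {d : ℕ} {f g : ℂ → ℂ} (hf : CPF d f) (hg : CPF d g) : CPF d (fun z => f z - g z) :=
  ⟨by simpa using hf.1.sub hg.1, by simpa using hf.2.sub hg.2⟩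

lemma CPF.mul {d e : ℕ} {f g : ℂ → ℂ} (hf : CPF d f) (hg : CPF e g) :
    CPF (d + e) (fun z => f z * g z) :=
  ⟨by simpa using (hf.1.mul hg.1).sub (hf.2.mul hg.2),
    by simpa using (hf.1.mul hg.2).add (hf.2.mul hg.1)⟩

lemma CPF.const (d : ℕ) (c : ℂ) : CPF d (fun _ => c) := ⟨PF.const _ _, PF.const _ _⟩
lemma CPF.id : CPF 1 (fun z => z) := ⟨PF.re, PF.im⟩
lemma CPF.conj {d : ℕ} {f : ℂ → ℂ} (hf : CPF d f) :
    CPF d (fun z => (starRingEnd ℂ) (f z)) := ⟨by simpa using hf.1, by simpa using hf.2.neg⟩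

lemma CPF.smul {d : ℕ} {f : ℂ → ℂ} (c : ℂ) (hf : CPF d f) : CPF d (fun z => c * f z) := by
  have := (CPF.const 0 c).mul hf
  rwa [zero_add] at this

/-- affine version of the top form. -/
noncomputable def Efun (K : ℕ) (z : ℂ) : ℝ :=
  ∏ j ∈ Finset.range K, (z.re ^ 2 + ((j : ℝ) + 1) * z.im ^ 2)

lemma eval_homog {A : MvPolynomial (Fin 3) ℝ} {e : ℕ} (he : A.IsHomogeneous e) (y : ℝ)
    (v : Fin 3 → ℝ) : eval (y • v) A = y ^ e * eval v A := by
  rw [eval_eq, eval_eq, Finset.mul_sum]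
  apply Finset.sum_congr rfl
  intro d hd
  have hdeg := he.degree_eq_sum_deg_support hd
  simp only [Pi.smul_apply, smul_eq_mul, mul_pow, Finset.prod_mul_distrib,
    Finset.prod_pow_eq_pow_sum]
  rw [hdeg]
  ring

theorem poly_final (K : ℕ) (hK : 1 ≤ K) (f0 : ℂ → ℝ) (h0 : PF (2 * K - 1) f0) (s : ℝ) (hs : 0 < s)
    (hfin : {z : ℂ | f0 z + s * Efun K z = 0}.Finite) :
    ∃ P : MvPolynomial (Fin 3) ℝ, P ≠ 0 ∧ P.IsHomogeneous (2 * K) ∧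
        Squarefree (MvPolynomial.map (algebraMap ℝ ℂ) P) ∧ (RZ P).Finite ∧
        (RZ P).ncard = {z : ℂ | f0 z + s * Efun K z = 0}.ncard := by
  obtain ⟨H0, h1, h2⟩ := h0
  have hh : (X 0 * H0 + C s * Eform K).IsHomogeneous (2 * K) := by
    refine IsHomogeneous.add ?_ ((Eform_homog K).C_mul s)
    have := (isHomogeneous_X ℝ (0 : Fin 3)).mul h1
    rwa [show 1 + (2 * K - 1) = 2 * K by omega] at this
  set P := X 0 * H0 + C s * Eform K with hP
  have sq := sqfree_main K H0 s hs hh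
  have evz : ∀ z : ℂ, eval ![1, z.re, z.im] P = f0 z + s * Efun K z := by
    intro z
    simp [hP, h2, Efun, Eform, map_prod]
  have ev0 : ∀ x y : ℝ, eval ![0, x, y] P = s * ∏ j ∈ Finset.range K, (x ^ 2 + ((j:ℝ) + 1) * y ^ 2) := by
    intro x y
    simp [hP, Eform, map_prod]
  have hmk : ∀ (v : Fin 3 → ℝ) (hv : v ≠ 0), Projectivization.mk ℝ v hv ∈ RZ P ↔ eval v P = 0 := by
    intro v hv
    obtain ⟨a, ha⟩ := Projectivization.exists_smul_eq_mk_rep ℝ v hv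
    unfold RZ
    rw [Set.mem_ofPred_eq, ← ha]
    have : a • v = (a : ℝ) • v := rfl
    rw [this, eval_homog hh]
    simp
  have nz : ∀ z : ℂ, (![1, z.re, z.im] : Fin 3 → ℝ) ≠ 0 := by
    intro z h
    have := congrFun h 0
    simp at this
  let emb : ℂ → Projectivization ℝ (Fin 3 → ℝ) := fun z => Projectivization.mk ℝ ![1, z.re, z.im] (nz z)
  have inj : Function.Injective emb := by
    intro z w h
    obtain ⟨a, ha⟩ := (Projectivization.mk_eq_mk_iff' ℝ _ _ _ _).1 h
    have a0 := congrFun ha 0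
    have a1 := congrFun ha 1
    have a2 := congrFun ha 2
    simp at a0 a1 a2
    subst a0
    apply Complex.ext <;> simp_all
  have img : RZ P = emb '' {z : ℂ | f0 z + s * Efun K z = 0} := by
    ext p
    induction p using Projectivization.ind with
    | h v hv =>
    rw [hmk]
    constructor
    · intro h
      by_cases hv0 : v 0 = 0
      · exfalso
        have hve : v = ![0, v 1, v 2] := by ext i; fin_cases i <;> simp [hv0]
        rw [hve, ev0] at h
        have : 0 < s * ∏ j ∈ Finset.range K, (v 1 ^ 2 + ((j:ℝ) + 1) * v 2 ^ 2) := by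
          apply mul_pos hs
          apply Finset.prod_pos
          intro j _
          by_cases h1 : v 1 = 0
          · have h2 : v 2 ≠ 0 := by
              intro h2; apply hv; rw [hve]; ext i; fin_cases i <;> simp [h1, h2]
            positivity
          · positivity
        linarith
      · refine ⟨⟨v 1 / v 0, v 2 / v 0⟩, ?_, ?_⟩
        · rw [Set.mem_ofPred_eq, ← evz]
          have hve : v = v 0 • ![1, v 1 / v 0, v 2 / v 0] := by
            ext i; fin_cases i <;> simp <;> field_simp
          rw [hve, eval_homog hh] at h
          rcases mul_eq_zero.1 h with h | h
          · exact absurd h (pow_ne_zero _ hv0)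
          · exact h
        · apply (Projectivization.mk_eq_mk_iff' ℝ _ _ _ _).2
          refine ⟨(v 0)⁻¹, ?_⟩
          ext i; fin_cases i <;> simp <;> field_simp
    · rintro ⟨z, hz, hzv⟩
      rw [← hmk v hv, ← hzv, hmk, evz]
      exact hz
  refine ⟨P, ?_, hh, sq, ?_, ?_⟩
  · intro h
    have := ev0 1 0
    rw [h] at this
    simp at this
    exact hs.ne this
  · rw [img]; exact hfin.image _
  · rw [img, Set.ncard_image_of_injective _ inj]


/-- `x, y, u` are the three roots of `t³ - z t² + z̄ t - 1`. -/
structure Rep3 (z x y u : ℂ) : Prop where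
  s1 : x + y + u = z
  s2 : x * y + y * u + u * x = (starRingEnd ℂ) z
  s3 : x * y * u = 1

/-- Generalized Chebyshev polynomials of type A2. -/
noncomputable def Tch : ℕ → ℂ → ℂ
  | 0, _ => 3
  | 1, z => z
  | 2, z => z ^ 2 - 2 * (starRingEnd ℂ) z
  | (n + 3), z => z * Tch (n + 2) z - (starRingEnd ℂ) z * Tch (n + 1) z + Tch n z

lemma Tch_rep {z x y u : ℂ} (h : Rep3 z x y u) : ∀ n, Tch n z = x ^ n + y ^ n + u ^ n
  | 0 => by simp [Tch]; norm_num
  | 1 => by simp [Tch, h.s1]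
  | 2 => by rw [Tch, ← h.s2, ← h.s1]; ring
  | (n + 3) => by
    rw [Tch, Tch_rep h (n + 2), Tch_rep h (n + 1), Tch_rep h n, ← h.s2, ← h.s1]
    linear_combination (- (x ^ n + y ^ n + u ^ n)) * h.s3

lemma Tch_conj (z : ℂ) : ∀ n, (starRingEnd ℂ) (Tch n z) = Tch n ((starRingEnd ℂ) z)
  | 0 => by simp [Tch, Complex.conj_ofNat]
  | 1 => by simp [Tch]
  | 2 => by simp [Tch, Complex.conj_ofNat]
  | (n + 3) => by
    rw [Tch, Tch, map_add, map_sub, map_mul, map_mul, Tch_conj z (n + 2), Tch_conj z (n + 1), Tch_conj z n]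

lemma Rep3.conj {z x y u : ℂ} (h : Rep3 z x y u) : Rep3 ((starRingEnd ℂ) z) (x * y) (y * u) (u * x) where
  s1 := h.s2
  s2 := by
    rw [Complex.conj_conj, ← h.s1]
    linear_combination (x + y + u) * h.s3
  s3 := by linear_combination (x * y * u + 1) * h.s3

lemma Tch_conj_rep {z x y u : ℂ} (h : Rep3 z x y u) (n : ℕ) :
    (starRingEnd ℂ) (Tch n z) = (x * y) ^ n + (y * u) ^ n + (u * x) ^ n := by
  rw [Tch_conj, Tch_rep h.conj]

lemma Tch_CPF : ∀ n, CPF n (Tch n)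
  | 0 => by
    have : Tch 0 = fun _ => 3 := by funext z; rw [Tch]
    rw [this]; exact CPF.const _ _
  | 1 => by
    have : Tch 1 = fun z => z := by funext z; rw [Tch]
    rw [this]; exact CPF.id
  | 2 => by
    have : Tch 2 = fun z => z ^ 2 - 2 * (starRingEnd ℂ) z := by funext z; rw [Tch]
    rw [this]
    have := (CPF.id.mul CPF.id).sub ((CPF.id.conj.smul 2).mono (by norm_num : 1 ≤ 1 + 1))
    simpa [pow_two] using this
  | (n + 3) => by
    have : Tch (n + 3) = fun z => z * Tch (n + 2) z - (starRingEnd ℂ) z * Tch (n + 1) z + Tch n z := by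
      funext z; rw [Tch]
    rw [this]
    have h1 := (CPF.id.mul (Tch_CPF (n + 2))).mono (by omega : _ ≤ n + 3)
    have h2 := (CPF.id.conj.mul (Tch_CPF (n + 1))).mono (by omega : _ ≤ n + 3)
    exact (h1.sub h2).add ((Tch_CPF n).mono (by omega))

/-- sum over ordered pairs. -/
def sum6 (a b : ℕ) (x y u : ℂ) : ℂ :=
  x ^ a * y ^ b + y ^ a * x ^ b + y ^ a * u ^ b + u ^ a * y ^ b + u ^ a * x ^ b + x ^ a * u ^ b

lemma symS_aux (a b : ℕ) (hab : b ≤ a) : ∃ F : ℂ → ℂ, CPF a F ∧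
    ∀ z x y u, Rep3 z x y u → F z = sum6 a b x y u := by
  obtain ⟨c, rfl⟩ := Nat.exists_eq_add_of_le hab
  have h1 := ((Tch_CPF b).conj.mul (Tch_CPF c))
  rcases le_total b c with h | h
  · obtain ⟨e, rfl⟩ := Nat.exists_eq_add_of_le h
    refine ⟨_, h1.sub ((Tch_CPF e).mono (by omega)), ?_⟩
    intro z x y u hr
    rw [Tch_conj_rep hr, Tch_rep hr, Tch_rep hr, sum6]
    have e1 : (x * y * u) ^ b = 1 := by rw [hr.s3, one_pow]
    simp only [mul_pow, pow_add] at *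
    linear_combination (-(x ^ e + y ^ e + u ^ e)) * (-e1)
  · obtain ⟨e, rfl⟩ := Nat.exists_eq_add_of_le h
    refine ⟨_, h1.sub ((Tch_CPF e).conj.mono (by omega)), ?_⟩
    intro z x y u hr
    rw [Tch_conj_rep hr, Tch_conj_rep hr, Tch_rep hr, sum6]
    have e1 : (x * y * u) ^ c = 1 := by rw [hr.s3, one_pow]
    simp only [mul_pow, pow_add] at *
    linear_combination (x ^ e * y ^ e + y ^ e * u ^ e + u ^ e * x ^ e) * e1

lemma symS_exists (a b d : ℕ) (ha : a ≤ d) (hb : b ≤ d) : ∃ F : ℂ → ℂ, CPF d F ∧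
    ∀ z x y u, Rep3 z x y u → F z = sum6 a b x y u := by
  rcases le_total b a with h | h
  · obtain ⟨F, h1, h2⟩ := symS_aux a b h
    exact ⟨F, h1.mono ha, h2⟩
  · obtain ⟨F, h1, h2⟩ := symS_aux b a h
    refine ⟨F, h1.mono hb, fun z x y u hr => ?_⟩
    rw [h2 z x y u hr]; unfold sum6; ring

lemma rep_of_theta (θ : Fin 3 → ℝ) (h : θ 0 + θ 1 + θ 2 = 0) :
    Rep3 (∑ i, Complex.exp (θ i * Complex.I)) (Complex.exp (θ 0 * Complex.I))
      (Complex.exp (θ 1 * Complex.I)) (Complex.exp (θ 2 * Complex.I)) where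
  s1 := by rw [Fin.sum_univ_three]
  s2 := by
    rw [Fin.sum_univ_three, map_add, map_add]
    simp only [← Complex.exp_conj, map_mul, Complex.conj_I, Complex.conj_ofReal, ← Complex.exp_add]
    have h' : (θ 0 : ℂ) + θ 1 + θ 2 = 0 := by exact_mod_cast h
    rw [show (θ 0 : ℂ) * Complex.I + θ 1 * Complex.I = θ 2 * -Complex.I by linear_combination Complex.I * h',
      show (θ 1 : ℂ) * Complex.I + θ 2 * Complex.I = θ 0 * -Complex.I by linear_combination Complex.I * h',
      show (θ 2 : ℂ) * Complex.I + θ 0 * Complex.I = θ 1 * -Complex.I by linear_combination Complex.I * h']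
    ring
  s3 := by
    rw [← Complex.exp_add, ← Complex.exp_add]
    have h' : (θ 0 : ℂ) + θ 1 + θ 2 = 0 := by exact_mod_cast h
    rw [show (θ 0 : ℂ) * Complex.I + θ 1 * Complex.I + θ 2 * Complex.I = 0 by linear_combination Complex.I * h']
    exact Complex.exp_zero

lemma exists_root3 (p : Polynomial ℂ) (h : p.natDegree ≠ 0) : ∃ x, p.eval x = 0 := by
  apply IsAlgClosed.exists_root
  intro h'
  exact h (Polynomial.natDegree_eq_of_degree_eq_some h')

lemma rep_exists (z : ℂ) : ∃ x y u, Rep3 z x y u := by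
  obtain ⟨x, hx⟩ := exists_root3
    (Polynomial.X ^ 3 - Polynomial.C z * Polynomial.X ^ 2 + Polynomial.C ((starRingEnd ℂ) z) * Polynomial.X - 1) (by
      have : (Polynomial.X ^ 3 - Polynomial.C z * Polynomial.X ^ 2 + Polynomial.C ((starRingEnd ℂ) z) * Polynomial.X - 1 : Polynomial ℂ).natDegree = 3 := by
        compute_degree!
      omega)
  simp at hx
  have x0 : x ≠ 0 := by rintro rfl; simp at hx
  obtain ⟨w, hw⟩ := IsAlgClosed.exists_pow_nat_eq ((z - x) ^ 2 - 4 / x) (n := 2) (by norm_num)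
  refine ⟨x, (z - x + w) / 2, (z - x - w) / 2, ⟨by ring, ?_, ?_⟩⟩
  · field_simp at hw
    apply mul_right_cancel₀ x0
    linear_combination (-1/4) * hw - hx
  · field_simp at hw
    linear_combination (-1/4) * hw

lemma rep_cases (z : ℂ) :
    (∃ θ : Fin 3 → ℝ, θ 0 + θ 1 + θ 2 = 0 ∧ z = ∑ i, Complex.exp (θ i * Complex.I)) ∨
    (∃ x y u : ℂ, Rep3 z x y u ∧ 1 < ‖x‖ ∧ y * (starRingEnd ℂ) x = 1 ∧ u * x = (starRingEnd ℂ) x) := by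
  obtain ⟨x, y, u, hr⟩ := rep_exists z
  have root : ∀ t : ℂ, t ^ 3 - z * t ^ 2 + (starRingEnd ℂ) z * t - 1 = (t - x) * (t - y) * (t - u) := by
    intro t
    rw [← hr.s2, ← hr.s1]; linear_combination hr.s3
  have recip : ∀ t s : ℂ, s * (starRingEnd ℂ) t = 1 → (t - x) * (t - y) * (t - u) = 0 →
      (s - x) * (s - y) * (s - u) = 0 := by
    intro t s hs ht
    rw [← root] at ht ⊢
    have := congrArg (starRingEnd ℂ) ht
    simp at this
    set t' := (starRingEnd ℂ) t
    linear_combination (-s ^ 3) * this + (s^2 * t' ^ 2 + s * t' + 1 + (starRingEnd ℂ) z * s * (-s * t' - 1)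
      + z * s ^ 2) * hs
  by_cases hall : ‖x‖ = 1 ∧ ‖y‖ = 1
  · left
    obtain ⟨hx, hy⟩ := hall
    have ex : Complex.exp (Complex.arg x * Complex.I) = x := by
      have := Complex.norm_mul_exp_arg_mul_I x; rw [hx] at this; simpa using this
    have ey : Complex.exp (Complex.arg y * Complex.I) = y := by
      have := Complex.norm_mul_exp_arg_mul_I y; rw [hy] at this; simpa using this
    refine ⟨![Complex.arg x, Complex.arg y, -(Complex.arg x + Complex.arg y)], by simp, ?_⟩
    rw [Fin.sum_univ_three]
    simp only [Matrix.cons_val_zero, Matrix.cons_val_one, Matrix.cons_val]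
    rw [ex, ey, ← hr.s1]
    congr 1
    push_cast
    rw [neg_mul, add_mul, Complex.exp_neg, Complex.exp_add, ex, ey]
    exact (eq_inv_of_mul_eq_one_right hr.s3)
  · right
    -- a root off the unit circle
    have key : ∀ t a b : ℂ, Rep3 z t a b → (∀ w, (w - x) * (w - y) * (w - u) = (w - t) * (w - a) * (w - b)) → ‖t‖ ≠ 1 →
        (∃ x y u : ℂ, Rep3 z x y u ∧ 1 < ‖x‖ ∧ y * (starRingEnd ℂ) x = 1 ∧ u * x = (starRingEnd ℂ) x) := by
      intro t a b hr' hw ht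
      have t0 : t ≠ 0 := by rintro rfl; have := hr'.s3; simp at this
      have ct0 : (starRingEnd ℂ) t ≠ 0 := by simpa using t0
      set s := ((starRingEnd ℂ) t)⁻¹ with hs
      have hs1 : s * (starRingEnd ℂ) t = 1 := inv_mul_cancel₀ ct0
      have hst : s ≠ t := by
        intro h
        rw [h, Complex.mul_conj, Complex.normSq_eq_norm_sq] at hs1
        have : ‖t‖ ^ 2 = 1 := by exact_mod_cast hs1
        exact ht (by nlinarith [norm_nonneg t])
      have h1 := recip t s hs1 (by rw [hw]; simp)
      rw [hw] at h1
      have : ∃ b', Rep3 z t s b' := by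
        rcases mul_eq_zero.1 h1 with h | h
        · rcases mul_eq_zero.1 h with h | h
          · exact absurd (sub_eq_zero.1 h) hst
          · rw [sub_eq_zero.1 h]; exact ⟨b, hr'⟩
        · rw [sub_eq_zero.1 h]
          exact ⟨a, ⟨by rw [← hr'.s1]; ring, by rw [← hr'.s2]; ring, by rw [← hr'.s3]; ring⟩⟩
      obtain ⟨b', hb'⟩ := this
      have hu : b' * t = (starRingEnd ℂ) t := by
        linear_combination (starRingEnd ℂ) t * hb'.s3 - t * b' * hs1
      rcases lt_or_gt_of_ne ht with h | h
      · refine ⟨s, t, b', ⟨by rw [← hb'.s1]; ring, by rw [← hb'.s2]; ring, by rw [← hb'.s3]; ring⟩, ?_, ?_, ?_⟩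
        · rw [hs, norm_inv]
          rw [RCLike.norm_conj]
          exact (one_lt_inv₀ (norm_pos_iff.2 t0)).2 h
        · have := congrArg (starRingEnd ℂ) hs1
          simp at this
          linear_combination this
        · have : (starRingEnd ℂ) s * t = 1 := by
            have := congrArg (starRingEnd ℂ) hs1
            simpa using this
          apply mul_right_cancel₀ t0
          rw [this]
          linear_combination hb'.s3
      · exact ⟨t, s, b', hb', h, hs1, hu⟩
    by_cases hx : ‖x‖ = 1
    · have hy : ‖y‖ ≠ 1 := fun h => hall ⟨hx, h⟩
      exact key y x u ⟨by rw [← hr.s1]; ring, by rw [← hr.s2]; ring, by rw [← hr.s3]; ring⟩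
        (fun w => by ring) hy
    · exact key x y u hr (fun w => rfl) hx


/-- bounds on a function, its first and second differences on a set. -/
structure Bd {E : Type*} [NormedAddCommGroup E] (S : Set E) (M L : ℝ) (f : E → ℝ) : Prop where
  hM : 0 ≤ M
  hL : 0 ≤ L
  bd : ∀ a ∈ S, |f a| ≤ M
  lip : ∀ a ∈ S, ∀ b ∈ S, |f a - f b| ≤ M * L * ‖a - b‖
  sec : ∀ m v, m ∈ S → m + v ∈ S → m - v ∈ S → |f (m + v) + f (m - v) - 2 * f m| ≤ M * L ^ 2 * ‖v‖ ^ 2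

namespace Bd
variable {E : Type*} [NormedAddCommGroup E] {S : Set E}

lemma const {c : ℝ} : Bd S |c| 0 (fun _ => c) where
  hM := abs_nonneg _
  hL := le_rfl
  bd _ _ := le_rfl
  lip _ _ _ _ := by simp
  sec _ _ _ _ _ := by
    have : c + c - 2 * c = 0 := by ring
    rw [this]; simp

lemma mono {M L M' L' : ℝ} {f : E → ℝ} (h : Bd S M L f) (hM : M ≤ M') (hL : L ≤ L') : Bd S M' L' f where
  hM := h.hM.trans hM
  hL := h.hL.trans hL
  bd a ha := (h.bd a ha).trans hM
  lip a ha b hb := (h.lip a ha b hb).trans (by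
    have := h.hL; have := h.hM
    have := h.hM.trans hM
    gcongr)
  sec m v h1 h2 h3 := (h.sec m v h1 h2 h3).trans (by
    have := h.hL; have := h.hM
    have := h.hM.trans hM
    gcongr)

lemma subset {T : Set E} {M L : ℝ} {f : E → ℝ} (h : Bd S M L f) (hT : T ⊆ S) : Bd T M L f where
  hM := h.hM
  hL := h.hL
  bd a ha := h.bd a (hT ha)
  lip a ha b hb := h.lip a (hT ha) b (hT hb)
  sec m v h1 h2 h3 := h.sec m v (hT h1) (hT h2) (hT h3)

lemma add {M L M' : ℝ} {f g : E → ℝ} (hf : Bd S M L f) (hg : Bd S M' L g) :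
    Bd S (M + M') L (fun a => f a + g a) where
  hM := add_nonneg hf.hM hg.hM
  hL := hf.hL
  bd a ha := (abs_add_le _ _).trans (add_le_add (hf.bd a ha) (hg.bd a ha))
  lip a ha b hb := by
    have h1 := hf.lip a ha b hb
    have h2 := hg.lip a ha b hb
    have h3 := abs_add_le (f a - f b) (g a - g b)
    rw [show f a + g a - (f b + g b) = f a - f b + (g a - g b) by ring]
    linarith
  sec m v h1 h2 h3 := by
    have h1' := hf.sec m v h1 h2 h3
    have h2' := hg.sec m v h1 h2 h3
    have h3' := abs_add_le (f (m + v) + f (m - v) - 2 * f m) (g (m + v) + g (m - v) - 2 * g m)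
    rw [show f (m + v) + g (m + v) + (f (m - v) + g (m - v)) - 2 * (f m + g m) =
      f (m + v) + f (m - v) - 2 * f m + (g (m + v) + g (m - v) - 2 * g m) by ring]
    linarith

lemma mul {M L M' L' : ℝ} {f g : E → ℝ} (hf : Bd S M L f) (hg : Bd S M' L' g) :
    Bd S (M * M') (L + L') (fun a => f a * g a) where
  hM := mul_nonneg hf.hM hg.hM
  hL := add_nonneg hf.hL hg.hL
  bd a ha := by
    rw [abs_mul]; exact mul_le_mul (hf.bd a ha) (hg.bd a ha) (abs_nonneg _) hf.hM
  lip a ha b hb := by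
    have h1 := hf.lip a ha b hb
    have h2 := hg.lip a ha b hb
    rw [show f a * g a - f b * g b = (f a - f b) * g a + f b * (g a - g b) by ring]
    refine (abs_add_le _ _).trans ?_
    rw [abs_mul, abs_mul]
    have e1 : |f a - f b| * |g a| ≤ (M * L * ‖a - b‖) * M' :=
      mul_le_mul h1 (hg.bd a ha) (abs_nonneg _) ((abs_nonneg _).trans h1)
    have e2 : |f b| * |g a - g b| ≤ M * (M' * L' * ‖a - b‖) :=
      mul_le_mul (hf.bd b hb) h2 (abs_nonneg _) hf.hM
    linarith
  sec m v h1 h2 h3 := by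
    have f1 := hf.sec m v h1 h2 h3
    have g1 := hg.sec m v h1 h2 h3
    have f2 := hf.lip _ h2 _ h1
    have f3 := hf.lip _ h3 _ h1
    have g2 := hg.lip _ h2 _ h1
    have g3 := hg.lip _ h3 _ h1
    rw [show m + v - m = v by abel] at f2 g2
    rw [show m - v - m = - v by abel, norm_neg] at f3 g3
    rw [show f (m + v) * g (m + v) + f (m - v) * g (m - v) - 2 * (f m * g m) =
      f m * (g (m + v) + g (m - v) - 2 * g m) + (f (m + v) + f (m - v) - 2 * f m) * g m +
      (f (m + v) - f m) * (g (m + v) - g m) + (f (m - v) - f m) * (g (m - v) - g m) by ring]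
    refine (abs_add_le _ _).trans ?_
    have a1 := abs_add_le (f m * (g (m + v) + g (m - v) - 2 * g m) + (f (m + v) + f (m - v) - 2 * f m) * g m)
      ((f (m + v) - f m) * (g (m + v) - g m))
    have a2 := abs_add_le (f m * (g (m + v) + g (m - v) - 2 * g m)) ((f (m + v) + f (m - v) - 2 * f m) * g m)
    rw [abs_mul, abs_mul] at a2
    rw [abs_mul (f (m + v) - f m)] at a1
    rw [abs_mul (f (m - v) - f m)]
    have e1 := mul_le_mul (hf.bd m h1) g1 (abs_nonneg _) hf.hM
    have e2 := mul_le_mul f1 (hg.bd m h1) (abs_nonneg _) ((abs_nonneg _).trans f1)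
    have e3 := mul_le_mul f2 g2 (abs_nonneg _) ((abs_nonneg _).trans f2)
    have e4 := mul_le_mul f3 g3 (abs_nonneg _) ((abs_nonneg _).trans f3)
    nlinarith

lemma congr {M L : ℝ} {f g : E → ℝ} (h : Bd S M L f) (hfg : ∀ a ∈ S, g a = f a) : Bd S M L g where
  hM := h.hM
  hL := h.hL
  bd a ha := by rw [hfg a ha]; exact h.bd a ha
  lip a ha b hb := by rw [hfg a ha, hfg b hb]; exact h.lip a ha b hb
  sec m v h1 h2 h3 := by rw [hfg _ h1, hfg _ h2, hfg _ h3]; exact h.sec m v h1 h2 h3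

lemma smul {M L : ℝ} {f : E → ℝ} (c : ℝ) (h : Bd S M L f) : Bd S (|c| * M) L (fun a => c * f a) := by
  have := (const (S := S) (c := c)).mul h
  simpa using this

lemma sum {ι : Type*} (s : Finset ι) {M : ι → ℝ} {L : ℝ} (hL : 0 ≤ L) {f : ι → E → ℝ}
    (h : ∀ i ∈ s, Bd S (M i) L (f i)) : Bd S (∑ i ∈ s, M i) L (fun a => ∑ i ∈ s, f i a) := by
  classical
  induction s using Finset.induction_on with
  | empty => simpa using (const (S := S) (c := 0)).mono (le_of_eq abs_zero) hL
  | insert i s hi ih =>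
    simp only [Finset.sum_insert hi]
    exact (h i (by simp)).add (ih (fun j hj => h j (by simp [hj])))

lemma prod {ι : Type*} (s : Finset ι) {M : ι → ℝ} {L : ι → ℝ} {f : ι → E → ℝ}
    (h : ∀ i ∈ s, Bd S (M i) (L i) (f i)) :
    Bd S (∏ i ∈ s, M i) (∑ i ∈ s, L i) (fun a => ∏ i ∈ s, f i a) := by
  classical
  induction s using Finset.induction_on with
  | empty => simpa using (const (S := S) (c := 1))
  | insert i s hi ih =>
    simp only [Finset.prod_insert hi, Finset.sum_insert hi]
    exact (h i (by simp)).mul (ih (fun j hj => h j (by simp [hj])))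

lemma pow {M L : ℝ} {f : E → ℝ} (h : Bd S M L f) (n : ℕ) : Bd S (M ^ n) (n * L) (fun a => f a ^ n) := by
  have := prod (S := S) (Finset.range n) (M := fun _ => M) (L := fun _ => L) (f := fun _ => f) (fun i _ => h)
  simpa using this

/-- replace the sup bound by a better one. -/
lemma improve {M L : ℝ} {f : E → ℝ} (h : Bd S M L f) {q : ℝ} (hq0 : 0 < q) (hq : q ≤ M)
    (hb : ∀ a ∈ S, |f a| ≤ q) : Bd S q (M * L / q) f where
  hM := hq0.le
  hL := div_nonneg (mul_nonneg h.hM h.hL) hq0.le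
  bd := hb
  lip a ha b hb := by
    rw [mul_div_cancel₀ _ hq0.ne']; exact h.lip a ha b hb
  sec m v h1 h2 h3 := by
    refine (h.sec m v h1 h2 h3).trans ?_
    refine mul_le_mul_of_nonneg_right ?_ (by positivity)
    rw [div_pow, ← mul_div_assoc, le_div_iff₀ (by positivity)]
    have := h.hM
    have : M * L ^ 2 * q * (M - q) ≥ 0 := mul_nonneg (by positivity) (by linarith)
    nlinarith

lemma cos_lin (l : E → ℝ) (hadd : ∀ a b, l (a + b) = l a + l b) (hneg : ∀ a, l (-a) = - l a) {L : ℝ} (hL : 0 ≤ L)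
    (hl : ∀ v, |l v| ≤ L * ‖v‖) (φ : ℝ) : Bd S 1 L (fun a => Real.cos (l a + φ)) where
  hM := zero_le_one
  hL := hL
  bd a _ := Real.abs_cos_le_one _
  lip a _ b _ := by
    have : l a - l b = l (a - b) := by rw [sub_eq_add_neg, sub_eq_add_neg, hadd, hneg]
    rw [one_mul]
    have h1 := hl (a - b)
    rw [Real.cos_sub_cos, abs_mul, abs_mul]
    have h2 := Real.abs_sin_le_one ((l a + φ + (l b + φ)) / 2)
    have h3 := Real.abs_sin_le_abs (x := (l a + φ - (l b + φ)) / 2)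
    have h4 : |(l a + φ - (l b + φ)) / 2| = |l (a - b)| / 2 := by
      rw [← this, abs_div, abs_of_pos (by norm_num : (0:ℝ) < 2)]; congr 2; ring
    rw [h4] at h3
    have : |(-2:ℝ)| = 2 := by norm_num
    rw [this]
    have := mul_le_mul h2 h3 (abs_nonneg _) zero_le_one
    linarith
  sec m v _ _ _ := by
    rw [sub_eq_add_neg m v, hadd, hadd, hneg]
    have e : Real.cos (l m + l v + φ) + Real.cos (l m + - l v + φ) - 2 * Real.cos (l m + φ)
        = - 4 * (Real.cos (l m + φ) * Real.sin (l v / 2) ^ 2) := by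
      rw [Real.sin_sq_eq_half_sub, show 2 * (l v / 2) = l v by ring,
        show l m + l v + φ = (l m + φ) + l v by ring, show l m + - l v + φ = (l m + φ) - l v by ring,
        Real.cos_add, Real.cos_sub]
      ring
    rw [e, abs_mul, abs_mul]
    have h1 := Real.abs_cos_le_one (l m + φ)
    have h2 := Real.abs_sin_le_abs (x := l v / 2)
    have h3 : |Real.sin (l v / 2) ^ 2| ≤ (L * ‖v‖ / 2) ^ 2 := by
      rw [abs_pow]
      refine pow_le_pow_left₀ (abs_nonneg _) (h2.trans ?_) 2
      rw [abs_div, abs_of_pos (by norm_num : (0:ℝ) < 2)]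
      have := hl v
      linarith
    have := mul_le_mul h1 h3 (abs_nonneg _) zero_le_one
    have e4 : |(-4:ℝ)| = 4 := by norm_num
    rw [e4]
    nlinarith

end Bd

/-- Abstract fixed point lemma. -/
lemma abstract_min {ι E : Type*} [Fintype ι] [DecidableEq ι] [TopologicalSpace E] (U : ι → Set E)
    (hU : ∀ p, IsCompact (U p)) (hne : ∀ p, (U p).Nonempty) (P0 : E → ℝ) (hP0 : Continuous P0)
    (Q : ι → E → ℝ) (hQ : ∀ q, Continuous (Q q)) (η : ℝ)
    (h : ∀ p q, ∀ a ∈ U p, |Q q a - (if q = p then 1 else 0)| ≤ η)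
    (hcard : (Fintype.card ι : ℝ) * η ≤ 1 / 2) (B : ℝ) (hB0 : 0 ≤ B) (hB1 : ∀ p, ∀ a ∈ U p, 0 ≤ P0 a)
    (hB2 : ∀ p, ∃ a ∈ U p, P0 a ≤ B) :
    ∃ c : ι → ℝ, (∀ p, |c p| ≤ 2 * B) ∧ ∀ p, (∀ a ∈ U p, 0 ≤ P0 a - ∑ q, c q * Q q a) ∧
      ∃ a ∈ U p, P0 a - ∑ q, c q * Q q a = 0 := by
  classical
  have hcont : ∀ c : ι → ℝ, Continuous (fun a => P0 a - ∑ q, c q * Q q a) := fun c => by fun_prop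
  have hmin : ∀ (c : ι → ℝ) p, ∃ a ∈ U p, ∀ b ∈ U p,
      P0 a - ∑ q, c q * Q q a ≤ P0 b - ∑ q, c q * Q q b := by
    intro c p
    obtain ⟨a, ha, h⟩ := (hU p).exists_isMinOn (hne p) (hcont c).continuousOn
    exact ⟨a, ha, fun b hb => h hb⟩
  choose am ham hmn using hmin
  let Φ : (ι → ℝ) → (ι → ℝ) := fun c p => P0 (am c p) - ∑ q, c q * Q q (am c p) + c p
  have key : ∀ c c' p, Φ c p - Φ c' p ≤ 1 / 2 * ‖c - c'‖ := by
    intro c c' p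
    have h1 := hmn c p (am c' p) (ham c' p)
    have h2 : ∑ q, (c' q - c q) * (Q q (am c' p) - (if q = p then 1 else 0)) ≤ 1 / 2 * ‖c - c'‖ := by
      calc _ ≤ ∑ q : ι, ‖c - c'‖ * η := by
            apply Finset.sum_le_sum
            intro q _
            refine (le_abs_self _).trans ?_
            rw [abs_mul]
            refine mul_le_mul ?_ (h p q _ (ham c' p)) (abs_nonneg _) (norm_nonneg _)
            rw [abs_sub_comm]
            exact norm_le_pi_norm (c - c') q
        _ = (Fintype.card ι * η) * ‖c - c'‖ := by simp; ring
        _ ≤ _ := by gcongr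
    have h3 : ∑ q, (c' q - c q) * (Q q (am c' p) - (if q = p then 1 else 0)) =
        ∑ q, c' q * Q q (am c' p) - ∑ q, c q * Q q (am c' p) - (c' p - c p) := by
      simp only [mul_sub, sub_mul, Finset.sum_sub_distrib]
      simp
    simp only [Φ]
    linarith
  have hlip : LipschitzWith (1 / 2) Φ := by
    apply LipschitzWith.of_dist_le_mul
    intro c c'
    rw [dist_eq_norm, dist_eq_norm]
    refine (pi_norm_le_iff_of_nonneg (by positivity)).2 fun p => ?_
    rw [Pi.sub_apply, Real.norm_eq_abs, abs_le]
    have h1 := key c c' p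
    have h2 := key c' c p
    rw [norm_sub_rev] at h2
    push_cast
    constructor <;> linarith
  have hctr : ContractingWith (1 / 2) Φ := ⟨by
    rw [← NNReal.coe_lt_coe]; push_cast; norm_num, hlip⟩
  let c := ContractingWith.fixedPoint Φ hctr
  have hc : Φ c = c := hctr.fixedPoint_isFixedPt
  have hc0 : ∀ p, P0 (am c p) - ∑ q, c q * Q q (am c p) = 0 := by
    intro p
    have := congrFun hc p
    simp only [Φ] at this
    linarith
  refine ⟨c, ?_, fun p => ⟨fun a ha => (hc0 p) ▸ hmn c p a ha, am c p, ham c p, hc0 p⟩⟩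
  have n0 : ‖Φ 0‖ ≤ B := by
    refine (pi_norm_le_iff_of_nonneg hB0).2 fun p => ?_
    have e : Φ 0 p = P0 (am 0 p) := by simp [Φ]
    rw [e, Real.norm_eq_abs, abs_of_nonneg (hB1 p _ (ham 0 p))]
    obtain ⟨a, ha, h⟩ := hB2 p
    have := hmn 0 p a ha
    simp at this
    exact this.trans h
  have n1 : ‖Φ c - Φ 0‖ ≤ 1 / 2 * ‖c‖ := by
    have := hlip.dist_le_mul c 0
    rw [dist_eq_norm, dist_eq_norm] at this
    simpa using this
  have n2 : ‖c‖ ≤ 2 * B := by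
    have := norm_add_le (Φ c - Φ 0) (Φ 0)
    rw [sub_add_cancel, hc] at this
    rw [hc] at n1
    linarith
  exact fun p => (norm_le_pi_norm c p).trans n2


lemma symS_ex2 (a b : ℕ) : ∃ F : ℂ → ℂ, CPF (max a b) F ∧
    ∀ z x y u, Rep3 z x y u → F z = sum6 a b x y u :=
  symS_exists a b _ (le_max_left _ _) (le_max_right _ _)

noncomputable def symF (a b : ℕ) : ℂ → ℂ := (symS_ex2 a b).choose

lemma symF_CPF (a b d : ℕ) (ha : a ≤ d) (hb : b ≤ d) : CPF d (symF a b) :=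
  (symS_ex2 a b).choose_spec.1.mono (max_le ha hb)

lemma symF_rep (a b : ℕ) {z x y u : ℂ} (h : Rep3 z x y u) : symF a b z = sum6 a b x y u :=
  (symS_ex2 a b).choose_spec.2 z x y u h

def tm (a b : ℕ) (X Y U : ℂ) : ℂ := X ^ a * Y ^ b + Y ^ a * U ^ b + U ^ a * X ^ b

lemma tm_sum6 (a b : ℕ) (P Q R x y u : ℂ) : tm a b P Q R * sum6 a b x y u =
    tm a b (P * x) (Q * y) (R * u) + tm a b (P * y) (Q * u) (R * x) + tm a b (P * u) (Q * x) (R * y) +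
    tm a b (P * y) (Q * x) (R * u) + tm a b (P * x) (Q * u) (R * y) + tm a b (P * u) (Q * y) (R * x) := by
  simp only [tm, sum6, mul_pow]; ring

noncomputable def Kc (n : ℕ) (X Y U : ℂ) : ℂ :=
  ∑ a ∈ Finset.range n, ∑ b ∈ Finset.range n, (tm a b X Y U + tm (a + 1) b X Y U + tm (a + 1) (b + 1) X Y U)

lemma Kc_one (n : ℕ) : Kc n 1 1 1 = 9 * n ^ 2 := by
  simp [Kc, tm]; ring

lemma Kc_geo (n : ℕ) (X Y U : ℂ) : Kc n X Y U =
    (1 + X + X * Y) * (∑ a ∈ Finset.range n, X ^ a) * (∑ a ∈ Finset.range n, Y ^ a) +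
    (1 + Y + Y * U) * (∑ a ∈ Finset.range n, Y ^ a) * (∑ a ∈ Finset.range n, U ^ a) +
    (1 + U + U * X) * (∑ a ∈ Finset.range n, U ^ a) * (∑ a ∈ Finset.range n, X ^ a) := by
  simp only [mul_assoc, Finset.sum_mul_sum]
  simp only [Finset.mul_sum, ← Finset.sum_add_distrib, Kc, tm]
  refine Finset.sum_congr rfl fun a _ => Finset.sum_congr rfl fun b _ => ?_
  ring

lemma Kc_zero (n : ℕ) (X Y U ω : ℂ) (h : X * Y * U = 1) (hX : X ^ n = ω) (hY : Y ^ n = ω) (hU : U ^ n = ω)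
    (hne : ¬ (X = 1 ∧ Y = 1 ∧ U = 1)) : Kc n X Y U = 0 := by
  rw [Kc_geo]
  have gX := geom_sum_mul X n
  have gY := geom_sum_mul Y n
  have gU := geom_sum_mul U n
  rw [hX] at gX; rw [hY] at gY; rw [hU] at gU
  generalize (∑ a ∈ Finset.range n, X ^ a) = A at *
  generalize (∑ a ∈ Finset.range n, Y ^ a) = B at *
  generalize (∑ a ∈ Finset.range n, U ^ a) = C at *
  by_cases hω : ω = 1
  · subst hω
    simp only [sub_self, mul_eq_zero, sub_eq_zero] at gX gY gU
    rcases gX with rfl | rfl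
    · rcases gY with rfl | rfl
      · simp
      · rcases gU with rfl | rfl
        · simp
        · simp at h; exact absurd ⟨h, rfl, rfl⟩ hne
    · rcases gY with rfl | rfl
      · rcases gU with rfl | rfl
        · simp
        · simp at h; exact absurd ⟨rfl, h, rfl⟩ hne
      · simp at h; exact absurd ⟨rfl, rfl, h⟩ hne
  · have aux : ∀ X A : ℂ, A * (X - 1) = ω - 1 → X - 1 ≠ 0 := by
      intro X A h h0
      rw [h0, mul_zero] at h
      exact hω (sub_eq_zero.1 h.symm)
    have x1 := aux X A gX
    have y1 := aux Y B gY
    have u1 := aux U C gU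
    have : ((1 + X + X * Y) * A * B + (1 + Y + Y * U) * B * C + (1 + U + U * X) * C * A) *
        ((X - 1) * (Y - 1) * (U - 1)) = 0 := by
      have e : ((1 + X + X * Y) * A * B + (1 + Y + Y * U) * B * C + (1 + U + U * X) * C * A) *
        ((X - 1) * (Y - 1) * (U - 1)) = (1 + X + X * Y) * (A * (X - 1)) * (B * (Y - 1)) * (U - 1) +
        (1 + Y + Y * U) * (B * (Y - 1)) * (C * (U - 1)) * (X - 1) +
        (1 + U + U * X) * (C * (U - 1)) * (A * (X - 1)) * (Y - 1) := by ring
      rw [e, gX, gY, gU]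
      linear_combination 3 * (ω - 1) ^ 2 * h
    rcases mul_eq_zero.1 this with h | h
    · exact h
    · exact absurd h (mul_ne_zero (mul_ne_zero x1 y1) u1)

/-- the complex exponential of an angle -/
noncomputable def ex (t : ℝ) : ℂ := Complex.exp (t * Complex.I)

lemma ex_add (s t : ℝ) : ex (s + t) = ex s * ex t := by simp [ex, add_mul, Complex.exp_add]
lemma ex_zero : ex 0 = 1 := by simp [ex]
lemma ex_nat (n : ℕ) (t : ℝ) : ex (n * t) = ex t ^ n := by
  simp only [ex]; rw [← Complex.exp_nat_mul]; push_cast; ring_nf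
lemma ex_re (t : ℝ) : (ex t).re = Real.cos t := by simp [ex, Complex.exp_ofReal_mul_I_re]
lemma ex_im (t : ℝ) : (ex t).im = Real.sin t := by simp [ex, Complex.exp_ofReal_mul_I_im]
lemma ex_norm (t : ℝ) : ‖ex t‖ = 1 := by simp [ex, Complex.norm_exp_ofReal_mul_I]
lemma ex_ne (t : ℝ) : ex t ≠ 0 := Complex.exp_ne_zero _
lemma ex_neg (t : ℝ) : ex (-t) = (ex t)⁻¹ := by simp [ex, Complex.exp_neg]
lemma ex_eq_iff (s t : ℝ) : ex s = ex t ↔ ∃ n : ℤ, s = t + n * (2 * Real.pi) := by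
  simp only [ex]
  rw [Complex.exp_eq_exp_iff_exists_int]
  constructor
  · rintro ⟨n, hn⟩
    refine ⟨n, ?_⟩
    have : ((s : ℂ)) = t + n * (2 * Real.pi) := by
      apply mul_right_cancel₀ Complex.I_ne_zero
      rw [hn]; ring
    exact_mod_cast this
  · rintro ⟨n, rfl⟩
    exact ⟨n, by push_cast; ring⟩

noncomputable def zt (θ : Fin 3 → ℝ) : ℂ := ex (θ 0) + ex (θ 1) + ex (θ 2)

/-- The sum zero hyperplane -/
def HH : Set (Fin 3 → ℝ) := {θ | θ 0 + θ 1 + θ 2 = 0}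

lemma zt_rep {θ : Fin 3 → ℝ} (h : θ ∈ HH) : Rep3 (zt θ) (ex (θ 0)) (ex (θ 1)) (ex (θ 2)) := by
  have := rep_of_theta θ h
  rwa [Fin.sum_univ_three] at this

noncomputable def Qp (k : ℕ) (p : Fin 3 → ℝ) (z : ℂ) : ℝ :=
  1 / (36 * (k : ℝ) ^ 2) * ∑ a ∈ Finset.range (2 * k), ∑ b ∈ Finset.range (2 * k),
    (tm a b (ex (- p 0)) (ex (- p 1)) (ex (- p 2)) * symF a b z +
     tm (a + 1) b (ex (- p 0)) (ex (- p 1)) (ex (- p 2)) * symF (a + 1) b z +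
     tm (a + 1) (b + 1) (ex (- p 0)) (ex (- p 1)) (ex (- p 2)) * symF (a + 1) (b + 1) z).re

lemma Qp_PF (k : ℕ) (p : Fin 3 → ℝ) : PF (2 * k) (Qp k p) := by
  unfold Qp
  refine PF.smul _ (PF.sum _ fun a ha => PF.sum _ fun b hb => ?_)
  rw [Finset.mem_range] at ha hb
  exact (((symF_CPF a b (2 * k) (by omega) (by omega)).smul _).add
    ((symF_CPF (a + 1) b (2 * k) (by omega) (by omega)).smul _)).add
    ((symF_CPF (a + 1) (b + 1) (2 * k) (by omega) (by omega)).smul _) |>.1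

lemma Qp_Kc (k : ℕ) (p : Fin 3 → ℝ) {z x y u : ℂ} (h : Rep3 z x y u) :
    Qp k p z = 1 / (36 * (k : ℝ) ^ 2) *
     (Kc (2 * k) (ex (- p 0) * x) (ex (- p 1) * y) (ex (- p 2) * u) +
      Kc (2 * k) (ex (- p 0) * y) (ex (- p 1) * u) (ex (- p 2) * x) +
      Kc (2 * k) (ex (- p 0) * u) (ex (- p 1) * x) (ex (- p 2) * y) +
      Kc (2 * k) (ex (- p 0) * y) (ex (- p 1) * x) (ex (- p 2) * u) +
      Kc (2 * k) (ex (- p 0) * x) (ex (- p 1) * u) (ex (- p 2) * y) +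
      Kc (2 * k) (ex (- p 0) * u) (ex (- p 1) * y) (ex (- p 2) * x)).re := by
  unfold Qp
  congr 1
  simp only [Kc, ← Finset.sum_add_distrib, ← Complex.re_sum, symF_rep _ _ h, tm_sum6]
  congr 1
  refine Finset.sum_congr rfl fun a _ => Finset.sum_congr rfl fun b _ => ?_
  ring

/-- nodes -/
structure Node (k : ℕ) (p : Fin 3 → ℝ) : Prop where
  sum0 : p ∈ HH
  h1 : ex (p 1) ^ (2 * k) = ex (p 0) ^ (2 * k)
  h2 : ex (p 2) ^ (2 * k) = ex (p 0) ^ (2 * k)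

lemma Kc_node (k : ℕ) {p : Fin 3 → ℝ} (hp : Node k p) {x y u ω : ℂ} (h : x * y * u = 1) (hx : x ^ (2 * k) = ω)
    (hy : y ^ (2 * k) = ω) (hu : u ^ (2 * k) = ω) (hne : ¬ (x = ex (p 0) ∧ y = ex (p 1) ∧ u = ex (p 2))) :
    Kc (2 * k) (ex (- p 0) * x) (ex (- p 1) * y) (ex (- p 2) * u) = 0 := by
  have n0 := ex_ne (p 0)
  have n1 := ex_ne (p 1)
  have n2 := ex_ne (p 2)
  apply Kc_zero _ _ _ _ ((ex (p 0) ^ (2 * k))⁻¹ * ω)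
  · have : ex (- p 0) * ex (- p 1) * ex (- p 2) = 1 := by
      rw [← ex_add, ← ex_add, show - p 0 + - p 1 + - p 2 = 0 by have := hp.sum0; simp only [HH, Set.mem_ofPred_eq] at this; linarith, ex_zero]
    linear_combination (x * y * u) * this + h
  · rw [mul_pow, hx, ex_neg, inv_pow]
  · rw [mul_pow, hy, ex_neg, inv_pow, hp.h1]
  · rw [mul_pow, hu, ex_neg, inv_pow, hp.h2]
  · rintro ⟨a, b, c⟩
    apply hne
    rw [ex_neg] at a b c
    field_simp at a b c
    exact ⟨a, b, c⟩

lemma Kc_self (k : ℕ) (p : Fin 3 → ℝ) :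
    Kc (2 * k) (ex (- p 0) * ex (p 0)) (ex (- p 1) * ex (p 1)) (ex (- p 2) * ex (p 2)) = 36 * (k : ℂ) ^ 2 := by
  simp only [← ex_add, neg_add_cancel, ex_zero]
  rw [Kc_one]; push_cast; ring

lemma Qp_node_ne (k : ℕ) {p q : Fin 3 → ℝ} (hp : Node k p) (hq : Node k q) (hne : zt q ≠ zt p) :
    Qp k p (zt q) = 0 := by
  rw [Qp_Kc k p (zt_rep hq.sum0)]
  have h3 := (zt_rep hq.sum0).s3
  have hz : ∀ x y u : ℂ, x + y + u = zt q → ¬ (x = ex (p 0) ∧ y = ex (p 1) ∧ u = ex (p 2)) := by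
    rintro x y u h ⟨rfl, rfl, rfl⟩
    exact hne h.symm
  rw [Kc_node k hp h3 rfl hq.h1 hq.h2 (hz _ _ _ rfl),
    Kc_node k hp (by rw [← h3]; ring) hq.h1 hq.h2 rfl (hz _ _ _ (by rw [zt]; ring)),
    Kc_node k hp (by rw [← h3]; ring) hq.h2 rfl hq.h1 (hz _ _ _ (by rw [zt]; ring)),
    Kc_node k hp (by rw [← h3]; ring) hq.h1 rfl hq.h2 (hz _ _ _ (by rw [zt]; ring)),
    Kc_node k hp (by rw [← h3]; ring) rfl hq.h2 hq.h1 (hz _ _ _ (by rw [zt]; ring)),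
    Kc_node k hp (by rw [← h3]; ring) hq.h2 hq.h1 rfl (hz _ _ _ (by rw [zt]; ring))]
  simp

lemma Qp_node_self (k : ℕ) (hk : 1 ≤ k) {p : Fin 3 → ℝ} (hp : Node k p) (h01 : ex (p 0) ≠ ex (p 1))
    (h12 : ex (p 1) ≠ ex (p 2)) (h02 : ex (p 0) ≠ ex (p 2)) : Qp k p (zt p) = 1 := by
  rw [Qp_Kc k p (zt_rep hp.sum0)]
  have h3 := (zt_rep hp.sum0).s3
  rw [Kc_self,
    Kc_node k hp (by rw [← h3]; ring) hp.h1 hp.h2 rfl (fun h => h01 h.1.symm),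
    Kc_node k hp (by rw [← h3]; ring) hp.h2 rfl hp.h1 (fun h => h02 h.1.symm),
    Kc_node k hp (by rw [← h3]; ring) hp.h1 rfl hp.h2 (fun h => h01 h.1.symm),
    Kc_node k hp (by rw [← h3]; ring) rfl hp.h2 hp.h1 (fun h => h12 h.2.1.symm),
    Kc_node k hp (by rw [← h3]; ring) hp.h2 hp.h1 rfl (fun h => h02 h.1.symm)]
  have : (k : ℝ) ≠ 0 := by positivity
  have e : (36 * (k : ℂ) ^ 2 + 0 + 0 + 0 + 0 + 0).re = 36 * (k : ℝ) ^ 2 := by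
    simp only [add_zero]
    have : (36 * (k : ℂ) ^ 2) = ((36 * (k : ℝ) ^ 2 : ℝ) : ℂ) := by push_cast; ring
    rw [this, Complex.ofReal_re]
  rw [e]; field_simp

/-- bound outside the torus -/
lemma sum6_bound {a b n : ℕ} (ha : a ≤ n) (hb : b ≤ n) {x y u : ℂ} (hx : 1 ≤ ‖x‖) (hy : ‖y‖ ≤ 1) (hu : ‖u‖ ≤ 1) :
    ‖sum6 a b x y u‖ ≤ 6 * ‖x‖ ^ n := by
  have xa : ‖x‖ ^ a ≤ ‖x‖ ^ n := pow_le_pow_right₀ hx ha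
  have xb : ‖x‖ ^ b ≤ ‖x‖ ^ n := pow_le_pow_right₀ hx hb
  have x1 : 1 ≤ ‖x‖ ^ n := one_le_pow₀ hx
  have ya : ‖y‖ ^ a ≤ 1 := pow_le_one₀ (norm_nonneg _) hy
  have yb : ‖y‖ ^ b ≤ 1 := pow_le_one₀ (norm_nonneg _) hy
  have ua : ‖u‖ ^ a ≤ 1 := pow_le_one₀ (norm_nonneg _) hu
  have ub : ‖u‖ ^ b ≤ 1 := pow_le_one₀ (norm_nonneg _) hu
  have m : ∀ s t : ℝ, 0 ≤ s → 0 ≤ t → s ≤ ‖x‖ ^ n → t ≤ 1 → s * t ≤ ‖x‖ ^ n := fun s t hs ht h1 h2 => by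
    nlinarith
  unfold sum6
  have e1 : ‖x ^ a * y ^ b‖ ≤ ‖x‖ ^ n := by
    rw [norm_mul, norm_pow, norm_pow]; exact m _ _ (by positivity) (by positivity) xa yb
  have e2 : ‖y ^ a * x ^ b‖ ≤ ‖x‖ ^ n := by
    rw [mul_comm, norm_mul, norm_pow, norm_pow]; exact m _ _ (by positivity) (by positivity) xb ya
  have e3 : ‖y ^ a * u ^ b‖ ≤ ‖x‖ ^ n := by
    rw [norm_mul, norm_pow, norm_pow]; exact m _ _ (by positivity) (by positivity) (ya.trans x1) ub
  have e4 : ‖u ^ a * y ^ b‖ ≤ ‖x‖ ^ n := by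
    rw [norm_mul, norm_pow, norm_pow]; exact m _ _ (by positivity) (by positivity) (ua.trans x1) yb
  have e5 : ‖u ^ a * x ^ b‖ ≤ ‖x‖ ^ n := by
    rw [mul_comm, norm_mul, norm_pow, norm_pow]; exact m _ _ (by positivity) (by positivity) xb ua
  have e6 : ‖x ^ a * u ^ b‖ ≤ ‖x‖ ^ n := by
    rw [norm_mul, norm_pow, norm_pow]; exact m _ _ (by positivity) (by positivity) xa ub
  refine (norm_add_le_of_le (norm_add_le_of_le (norm_add_le_of_le (norm_add_le_of_le (norm_add_le_of_le e1 e2) e3) e4) e5) e6).trans ?_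
  linarith

lemma tm_bound (a b : ℕ) (p q r : ℝ) : ‖tm a b (ex p) (ex q) (ex r)‖ ≤ 3 := by
  unfold tm
  refine (norm_add_le_of_le (norm_add_le_of_le (le_refl _) (le_refl _)) (le_refl _)).trans ?_
  simp only [norm_mul, norm_pow, ex_norm]; norm_num

lemma Qp_outside (k : ℕ) (hk : 1 ≤ k) (p : Fin 3 → ℝ) {z x y u : ℂ} (h : Rep3 z x y u) (hx : 1 ≤ ‖x‖)
    (hy : ‖y‖ ≤ 1) (hu : ‖u‖ ≤ 1) : |Qp k p z| ≤ 6 * ‖x‖ ^ (2 * k) := by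
  unfold Qp
  rw [abs_mul, abs_of_nonneg (by positivity : (0:ℝ) ≤ 1 / (36 * (k:ℝ) ^ 2))]
  have k0 : (0:ℝ) < k := by positivity
  rw [div_mul_eq_mul_div, one_mul, div_le_iff₀ (by positivity)]
  have T : ∀ a b, a ≤ 2 * k → b ≤ 2 * k →
      ‖tm a b (ex (- p 0)) (ex (- p 1)) (ex (- p 2)) * symF a b z‖ ≤ 3 * (6 * ‖x‖ ^ (2 * k)) := by
    intro a b ha hb
    rw [norm_mul, symF_rep a b h]
    exact mul_le_mul (tm_bound _ _ _ _ _) (sum6_bound ha hb hx hy hu) (norm_nonneg _) (by norm_num)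
  calc _ ≤ ∑ a ∈ Finset.range (2 * k), ∑ b ∈ Finset.range (2 * k), 3 * (3 * (6 * ‖x‖ ^ (2 * k))) := by
        refine (Finset.abs_sum_le_sum_abs _ _).trans (Finset.sum_le_sum fun a ha => ?_)
        refine (Finset.abs_sum_le_sum_abs _ _).trans (Finset.sum_le_sum fun b hb => ?_)
        rw [Finset.mem_range] at ha hb
        refine (Complex.abs_re_le_norm _).trans ?_
        refine (norm_add_le_of_le (norm_add_le_of_le (T _ _ (by omega) (by omega)) (T _ _ (by omega) (by omega)))
          (T _ _ (by omega) (by omega))).trans ?_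
        linarith
    _ = _ := by simp; ring

lemma Bd_cos2 (S : Set (Fin 3 → ℝ)) (i j : Fin 3) (a b n : ℕ) (ha : a ≤ n) (hb : b ≤ n) (p q : ℝ) :
    Bd S 1 (2 * n) (fun θ => ((ex p * ex (θ i)) ^ a * (ex q * ex (θ j)) ^ b).re) := by
  have e : ∀ θ : Fin 3 → ℝ, ((ex p * ex (θ i)) ^ a * (ex q * ex (θ j)) ^ b).re =
      Real.cos ((a * θ i + b * θ j) + (a * p + b * q)) := by
    intro θ
    rw [← ex_add, ← ex_add, ← ex_nat, ← ex_nat, ← ex_add, ex_re]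
    congr 1; ring
  simp only [e]
  refine Bd.cos_lin (fun θ : Fin 3 → ℝ => (a : ℝ) * θ i + b * θ j) ?_ ?_ (by positivity) ?_ _
  · intro x y; simp; ring
  · intro x; simp; ring
  · intro v
    have h1 := norm_le_pi_norm v i
    have h2 := norm_le_pi_norm v j
    rw [Real.norm_eq_abs] at h1 h2
    have ha' : (a : ℝ) ≤ n := by exact_mod_cast ha
    have hb' : (b : ℝ) ≤ n := by exact_mod_cast hb
    refine (abs_add_le _ _).trans ?_
    rw [abs_mul, abs_mul, Nat.abs_cast, Nat.abs_cast]
    have := mul_le_mul ha' h1 (abs_nonneg _) (by positivity)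
    have := mul_le_mul hb' h2 (abs_nonneg _) (by positivity)
    linarith

lemma Bd_tm (S : Set (Fin 3 → ℝ)) (i j l : Fin 3) (a b n : ℕ) (ha : a ≤ n) (hb : b ≤ n) (p q r : ℝ) :
    Bd S 3 (2 * n) (fun θ => (tm a b (ex p * ex (θ i)) (ex q * ex (θ j)) (ex r * ex (θ l))).re) := by
  have := ((Bd_cos2 S i j a b n ha hb p q).add (Bd_cos2 S j l a b n ha hb q r)).add
    (Bd_cos2 S l i a b n ha hb r p)
  refine (this.mono (by norm_num) le_rfl).congr fun θ _ => ?_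
  simp only [tm, Complex.add_re]

lemma Bd_tm6 (a b n : ℕ) (ha : a ≤ n) (hb : b ≤ n) (p q r : ℝ) :
    Bd HH 18 (2 * n) (fun θ => (tm a b (ex p) (ex q) (ex r) * symF a b (zt θ)).re) := by
  have := (((((Bd_tm HH 0 1 2 a b n ha hb p q r).add (Bd_tm HH 1 2 0 a b n ha hb p q r)).add
    (Bd_tm HH 2 0 1 a b n ha hb p q r)).add (Bd_tm HH 1 0 2 a b n ha hb p q r)).add
    (Bd_tm HH 0 2 1 a b n ha hb p q r)).add (Bd_tm HH 2 1 0 a b n ha hb p q r)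
  refine (this.mono (by norm_num) le_rfl).congr fun θ hθ => ?_
  rw [symF_rep a b (zt_rep hθ), tm_sum6]
  simp only [Complex.add_re]

lemma Qp_Bd (k : ℕ) (hk : 1 ≤ k) (p : Fin 3 → ℝ) : Bd HH 6 (4 * k) (fun θ => Qp k p (zt θ)) := by
  have k0 : (0:ℝ) < k := by positivity
  have h : Bd HH (∑ a ∈ Finset.range (2 * k), ∑ b ∈ Finset.range (2 * k), 54) (4 * k)
    (fun θ => ∑ a ∈ Finset.range (2 * k), ∑ b ∈ Finset.range (2 * k),
    (tm a b (ex (- p 0)) (ex (- p 1)) (ex (- p 2)) * symF a b (zt θ) +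
     tm (a + 1) b (ex (- p 0)) (ex (- p 1)) (ex (- p 2)) * symF (a + 1) b (zt θ) +
     tm (a + 1) (b + 1) (ex (- p 0)) (ex (- p 1)) (ex (- p 2)) * symF (a + 1) (b + 1) (zt θ)).re) := by
    refine Bd.sum _ (by positivity) fun a ha => Bd.sum _ (by positivity) fun b hb => ?_
    rw [Finset.mem_range] at ha hb
    have := ((Bd_tm6 a b (2 * k) (by omega) (by omega) (- p 0) (- p 1) (- p 2)).add
      (Bd_tm6 (a + 1) b (2 * k) (by omega) (by omega) (- p 0) (- p 1) (- p 2))).add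
      (Bd_tm6 (a + 1) (b + 1) (2 * k) (by omega) (by omega) (- p 0) (- p 1) (- p 2))
    refine (this.mono (by norm_num) (by push_cast; linarith)).congr fun θ _ => ?_
    simp only [Complex.add_re]
  refine ((h.smul (1 / (36 * (k : ℝ) ^ 2))).mono ?_ le_rfl).congr fun θ _ => rfl
  rw [abs_of_nonneg (by positivity)]
  simp
  field_simp
  ring_nf
  rfl


lemma abs_sin_ge {x : ℝ} (h : |x| ≤ Real.pi / 2) : 2 / Real.pi * |x| ≤ |Real.sin x| := by
  have h1 := Real.mul_le_sin (abs_nonneg x) h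
  refine h1.trans ?_
  rcases abs_cases x with ⟨e, _⟩ | ⟨e, _⟩ <;> rw [e]
  · exact le_abs_self _
  · rw [Real.sin_neg]; exact neg_le_abs _

lemma cos_two_pi_div_three : Real.cos (2 * Real.pi / 3) = - (1 / 2) := by
  rw [show 2 * Real.pi / 3 = Real.pi - Real.pi / 3 by ring, Real.cos_pi_sub, Real.cos_pi_div_three]

lemma cos_half_near {s : ℝ} (h0 : 0 ≤ s) (h1 : s ≤ Real.pi) :
    |s - 2 * Real.pi / 3| ≤ Real.pi * |Real.cos s + 1 / 2| := by
  have hpi := Real.pi_pos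
  have e : Real.cos s + 1 / 2 = Real.cos s - Real.cos (2 * Real.pi / 3) := by
    rw [cos_two_pi_div_three]; ring
  rw [e, Real.cos_sub_cos, abs_mul, abs_mul]
  have a1 : 1 / 2 ≤ Real.sin ((s + 2 * Real.pi / 3) / 2) := by
    rcases le_total ((s + 2 * Real.pi / 3) / 2) (Real.pi / 2) with h | h
    · rw [← Real.sin_pi_div_six]
      apply Real.sin_le_sin_of_le_of_le_pi_div_two <;> linarith
    · rw [← Real.sin_pi_div_six, ← Real.sin_pi_sub ((s + 2 * Real.pi / 3) / 2)]
      apply Real.sin_le_sin_of_le_of_le_pi_div_two <;> linarith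
  have a2 := abs_sin_ge (x := (s - 2 * Real.pi / 3) / 2) (by
    rw [abs_le]; constructor <;> linarith)
  rw [abs_div, abs_of_pos (by norm_num : (0:ℝ) < 2)] at a2
  have a3 : |(-2:ℝ)| = 2 := by norm_num
  rw [a3]
  have a4 := a1.trans (le_abs_self _)
  set A := |Real.sin ((s + 2 * Real.pi / 3) / 2)|
  set B := |Real.sin ((s - 2 * Real.pi / 3) / 2)|
  set D := |s - 2 * Real.pi / 3|
  have b1 : D = Real.pi * (2 / Real.pi * (D / 2)) := by field_simp
  calc D = Real.pi * (2 / Real.pi * (D / 2)) := b1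
    _ ≤ Real.pi * B := by gcongr
    _ ≤ Real.pi * (2 * A * B) := by
      have : 0 ≤ B := abs_nonneg _
      gcongr
      nlinarith

lemma near_reduced (s d η : ℝ) (h0 : 0 < η) (h1 : η ≤ 1) (hs : |s| ≤ Real.pi) (hd : |d| ≤ Real.pi / 2)
    (hg : 2 * Real.cos s * Real.cos d + 2 * Real.cos s ^ 2 + 1 / 2 < η ^ 2 / 400) :
    |d| ≤ η / 2 ∧ ∃ t : ℝ, (3 * t = 2 * Real.pi ∨ 3 * t = - (2 * Real.pi)) ∧ |s - t| ≤ η / 2 := by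
  have hpi := Real.pi_pos
  have hpi4 := Real.pi_le_four
  have e : 2 * Real.cos s * Real.cos d + 2 * Real.cos s ^ 2 + 1 / 2 =
    2 * (Real.cos s + 1 / 2 * Real.cos d) ^ 2 + 1 / 2 * Real.sin d ^ 2 := by
    have := Real.sin_sq_add_cos_sq d
    linear_combination (-1/2) * this
  rw [e] at hg
  have c0 : 0 ≤ Real.cos d := Real.cos_nonneg_of_mem_Icc (by rw [abs_le] at hd; exact hd)
  have c1 := Real.cos_le_one d
  have hsd : |Real.sin d| ≤ η / 14 := by
    apply abs_le_of_sq_le_sq _ (by positivity)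
    nlinarith [sq_nonneg (Real.cos s + 1 / 2 * Real.cos d)]
  have hcs : |Real.cos s + 1 / 2 * Real.cos d| ≤ η / 28 := by
    apply abs_le_of_sq_le_sq _ (by positivity)
    nlinarith [sq_nonneg (Real.sin d)]
  have hcd : 1 - Real.cos d ≤ η / 196 := by
    have := Real.sin_sq_add_cos_sq d
    have : Real.sin d ^ 2 ≤ (η / 14) ^ 2 := sq_le_sq' (by linarith [(abs_le.1 hsd).1]) (abs_le.1 hsd).2
    nlinarith
  have hc : |Real.cos s + 1 / 2| ≤ η / 20 := by
    rw [abs_le] at hcs ⊢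
    constructor <;> linarith
  constructor
  · have := abs_sin_ge hd
    have h2 : 2 / Real.pi * |d| ≤ η / 14 := this.trans hsd
    rw [div_mul_eq_mul_div, div_le_iff₀ hpi] at h2
    nlinarith
  · have key : |(|s| - 2 * Real.pi / 3)| ≤ η / 2 := by
      have := cos_half_near (abs_nonneg s) hs
      rw [Real.cos_abs] at this
      nlinarith [abs_nonneg (Real.cos s + 1 / 2)]
    rcases abs_cases s with ⟨e, _⟩ | ⟨e, _⟩
    · exact ⟨2 * Real.pi / 3, Or.inl (by ring), by rwa [e] at key⟩
    · refine ⟨- (2 * Real.pi / 3), Or.inr (by ring), ?_⟩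
      rw [e] at key
      rw [← abs_neg]
      convert key using 2; ring

lemma near_alpha (α : Fin 3 → ℝ) (hα : α 0 + α 1 + α 2 = 0) (η : ℝ) (h0 : 0 < η) (h1 : η ≤ 1)
    (hg : Real.cos (α 0) + Real.cos (α 1) + Real.cos (α 2) + 3 / 2 < η ^ 2 / 400) :
    ∃ γ : Fin 3 → ℝ, γ 0 + γ 1 + γ 2 = 0 ∧ ex (γ 1) = ex (γ 0) ∧ ex (γ 2) = ex (γ 0) ∧
      ∀ i, |α i - γ i| ≤ η := by
  have hpi := Real.pi_pos
  set s := (α 0 + α 1) / 2 with hs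
  set d := (α 0 - α 1) / 2 with hd
  set n := round (d / Real.pi) with hn
  set d' := d - n * Real.pi with hd'
  set s1 := s - n * Real.pi with hs1
  set n' := round (s1 / (2 * Real.pi)) with hn'
  set s' := s1 - n' * (2 * Real.pi) with hs'
  have bd' : |d'| ≤ Real.pi / 2 := by
    have := abs_sub_round (d / Real.pi)
    have e : d' = (d / Real.pi - n) * Real.pi := by rw [hd']; field_simp
    rw [e, abs_mul, abs_of_pos hpi]; nlinarith
  have bs' : |s'| ≤ Real.pi := by
    have := abs_sub_round (s1 / (2 * Real.pi))
    have e : s' = (s1 / (2 * Real.pi) - n') * (2 * Real.pi) := by rw [hs']; field_simp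
    rw [e, abs_mul, abs_of_pos (by positivity : 0 < 2 * Real.pi)]; nlinarith
  have cd : Real.cos d = (-1) ^ n * Real.cos d' := by
    rw [← Real.cos_add_int_mul_pi, hd']; congr 1; ring
  have cs : Real.cos s = (-1) ^ n * Real.cos s' := by
    rw [← Real.cos_add_int_mul_pi, show s' + n * Real.pi = s - n' * (2 * Real.pi) by rw [hs', hs1]; ring,
      Real.cos_sub_int_mul_two_pi]
  have sq1 : ((-1 : ℝ) ^ n) * (-1) ^ n = 1 := by
    rw [← mul_zpow]; norm_num
  have hg' : 2 * Real.cos s' * Real.cos d' + 2 * Real.cos s' ^ 2 + 1 / 2 < η ^ 2 / 400 := by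
    refine lt_of_le_of_lt (le_of_eq ?_) hg
    rw [show α 0 = s + d by rw [hs, hd]; ring, show α 1 = s - d by rw [hs, hd]; ring,
      show α 2 = - (2 * s) by rw [hs]; linarith, Real.cos_neg, Real.cos_two_mul, Real.cos_add s d, Real.cos_sub s d, cd, cs]
    linear_combination (-2 * Real.cos s' * Real.cos d' - 2 * Real.cos s' ^ 2) * sq1
  obtain ⟨hd2, t, ht, hst⟩ := near_reduced s' d' η h0 h1 bs' bd' hg'
  refine ⟨![t + (n' + n) * (2 * Real.pi), t + n' * (2 * Real.pi), -2 * t - (2 * n' + n) * (2 * Real.pi)],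
    by simp; ring, ?_, ?_, ?_⟩
  · simp only [Matrix.cons_val_zero, Matrix.cons_val_one]
    exact (ex_eq_iff _ _).2 ⟨-n, by push_cast; ring⟩
  · simp only [Matrix.cons_val_zero, Matrix.cons_val]
    rcases ht with ht | ht
    · exact (ex_eq_iff _ _).2 ⟨-(3 * n' + 2 * n) - 1, by push_cast; linarith⟩
    · exact (ex_eq_iff _ _).2 ⟨-(3 * n' + 2 * n) + 1, by push_cast; linarith⟩
  · rw [abs_le] at hd2 hst
    have e0 : α 0 = s' + d' + (n' + n) * (2 * Real.pi) := by
      rw [hs', hs1, hd', hs, hd]; ring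
    have e1 : α 1 = s' - d' + n' * (2 * Real.pi) := by
      rw [hs', hs1, hd', hs, hd]; ring
    have e2 : α 2 = -2 * s' - (2 * n' + n) * (2 * Real.pi) := by
      rw [hs', hs1, hs]; linarith
    rw [Fin.forall_fin_succ, Fin.forall_fin_succ, Fin.forall_fin_one]
    simp only [Fin.succ_zero_eq_one, Fin.succ_one_eq_two, Matrix.cons_val_zero, Matrix.cons_val_one, Matrix.cons_val]
    rw [e0, e1, e2]
    refine ⟨?_, ?_, ?_⟩ <;> rw [abs_le] <;> constructor <;> linarith

/-- main term -/
noncomputable def Gf (k : ℕ) (z : ℂ) : ℝ := (Tch (2 * k) z).re + 3 / 2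

lemma Gf_PF (k : ℕ) : PF (2 * k) (Gf k) := (Tch_CPF (2 * k)).1.add (PF.const _ _)

lemma Gf_zt (k : ℕ) {θ : Fin 3 → ℝ} (h : θ ∈ HH) : Gf k (zt θ) =
    Real.cos (2 * k * θ 0) + Real.cos (2 * k * θ 1) + Real.cos (2 * k * θ 2) + 3 / 2 := by
  rw [Gf, Tch_rep (zt_rep h), ← ex_nat, ← ex_nat, ← ex_nat]
  simp only [Complex.add_re, ex_re]
  push_cast; ring

lemma Gf_nonneg (k : ℕ) {θ : Fin 3 → ℝ} (h : θ ∈ HH) : 0 ≤ Gf k (zt θ) := by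
  rw [Gf_zt k h]
  set s := (2 * k * θ 0 + 2 * k * θ 1) / 2 with hs
  set d := (2 * k * θ 0 - 2 * k * θ 1) / 2 with hd
  have h' : θ 0 + θ 1 + θ 2 = 0 := h
  rw [show 2 * k * θ 0 = s + d by rw [hs, hd]; ring, show 2 * k * θ 1 = s - d by rw [hs, hd]; ring,
      show 2 * k * θ 2 = - (2 * s) by rw [hs]; linear_combination 2 * k * h', Real.cos_neg, Real.cos_two_mul, Real.cos_add, Real.cos_sub]
  nlinarith [sq_nonneg (Real.cos s + 1 / 2 * Real.cos d), sq_nonneg (Real.sin d), Real.sin_sq_add_cos_sq d]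

lemma near_node (k : ℕ) (hk : 1 ≤ k) {θ : Fin 3 → ℝ} (h : θ ∈ HH) (ρ : ℝ) (h0 : 0 < ρ) (h1 : 2 * k * ρ ≤ 1)
    (hg : Gf k (zt θ) < (2 * k * ρ) ^ 2 / 400) : ∃ p, Node k p ∧ ‖θ - p‖ ≤ ρ := by
  have k0 : (0:ℝ) < k := by positivity
  rw [Gf_zt k h] at hg
  have h' : θ 0 + θ 1 + θ 2 = 0 := h
  obtain ⟨γ, g0, g1, g2, hγ⟩ := near_alpha (fun i => 2 * k * θ i) (by linear_combination 2 * k * h')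
    (2 * k * ρ) (by positivity) h1 hg
  have e : ∀ i, ex (γ i / (2 * k)) ^ (2 * k) = ex (γ i) := by
    intro i
    rw [← ex_nat]; push_cast; congr 1; field_simp
  refine ⟨fun i => γ i / (2 * k), ⟨?_, ?_, ?_⟩, ?_⟩
  · change γ 0 / (2 * k) + γ 1 / (2 * k) + γ 2 / (2 * k) = 0
    rw [← add_div, ← add_div, g0, zero_div]
  · rw [e, e, g1]
  · rw [e, e, g2]
  · refine (pi_norm_le_iff_of_nonneg h0.le).2 fun i => ?_
    have := hγ i
    simp only [Pi.sub_apply, Real.norm_eq_abs]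
    rw [show 2 * k * θ i - γ i = (2 * k) * (θ i - γ i / (2 * k)) by field_simp, abs_mul,
      abs_of_pos (by positivity : (0:ℝ) < 2 * k)] at this
    exact le_of_mul_le_mul_left this (by positivity)

/-- second difference lower bound for the main term -/
lemma Gf_sec (k : ℕ) (hk : 1 ≤ k) {m v : Fin 3 → ℝ} (hm : m ∈ HH) (hp : m + v ∈ HH) (hn : m - v ∈ HH)
    (hc : ∀ i, Real.cos (2 * k * m i) ≤ - (1 / 4)) (hv : ∀ i, |2 * k * v i| ≤ Real.pi) :
    (k : ℝ) ^ 2 / 4 * ‖v‖ ^ 2 ≤ Gf k (zt (m + v)) + Gf k (zt (m - v)) - 2 * Gf k (zt m) := by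
  rw [Gf_zt k hm, Gf_zt k hp, Gf_zt k hn]
  have T : ∀ i, (k : ℝ) ^ 2 / 4 * (v i) ^ 2 ≤ Real.cos (2 * k * (m + v) i) + Real.cos (2 * k * (m - v) i) - 2 * Real.cos (2 * k * m i) := by
    intro i
    rw [Pi.add_apply, Pi.sub_apply, mul_add, mul_sub, Real.cos_add, Real.cos_sub]
    have h1 := Real.cos_le_one_sub_mul_cos_sq (hv i)
    have h2 := hc i
    have h3 : 1 / 16 ≤ 1 / Real.pi ^ 2 := by
      have := Real.pi_le_four
      have := Real.pi_pos
      apply one_div_le_one_div_of_le (by positivity)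
      nlinarith
    have h4 : (1 / 8) * (2 * k * v i) ^ 2 ≤ 1 - Real.cos (2 * k * v i) := by
      have : 2 / Real.pi ^ 2 = 2 * (1 / Real.pi ^ 2) := by ring
      rw [this] at h1
      nlinarith [sq_nonneg (2 * k * v i)]
    nlinarith [Real.cos_le_one (2 * k * v i)]
  have P : ∀ i, (0:ℝ) ≤ (k : ℝ) ^ 2 / 4 * (v i) ^ 2 := fun i => by positivity
  have Z : ∃ i, ‖v‖ = |v i| := by
    by_contra hcon
    push Not at hcon
    have h1 : ∀ i, ‖v i‖ < ‖v‖ := fun i => lt_of_le_of_ne (norm_le_pi_norm v i) (fun h => hcon i h.symm)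
    have h2 : 0 < ‖v‖ := (norm_nonneg _).trans_lt (h1 0)
    exact lt_irrefl _ ((pi_norm_lt_iff h2).2 h1)
  obtain ⟨i, hi⟩ := Z
  rw [hi, sq_abs]
  have t0 := T 0; have t1 := T 1; have t2 := T 2
  have p0 := P 0; have p1 := P 1; have p2 := P 2
  fin_cases i <;> simp only [Fin.zero_eta, Fin.mk_one, Fin.reduceFinMk] <;> linarith


lemma PF.continuous {d : ℕ} {f : ℂ → ℝ} (h : PF d f) : Continuous f := by
  obtain ⟨H, _, hH⟩ := h
  have : f = fun z => eval ![1, z.re, z.im] H := by funext z; exact (hH z).symm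
  rw [this]
  refine (MvPolynomial.continuous_eval H).comp ?_
  refine continuous_pi fun i => ?_
  fin_cases i
  · exact continuous_const
  · exact Complex.continuous_re
  · exact Complex.continuous_im

lemma ex_continuous : Continuous ex := by unfold ex; fun_prop

lemma zt_continuous : Continuous zt := by
  unfold zt
  have h := ex_continuous
  fun_prop

noncomputable def Del (z : ℂ) : ℝ :=
  27 - (z.re ^ 2 + z.im ^ 2) ^ 2 + 8 * (z.re ^ 3 - 3 * (z.re * z.im ^ 2)) - 18 * (z.re ^ 2 + z.im ^ 2)

lemma Del_PF : PF 4 Del := by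
  have n2 : PF 2 (fun z => z.re ^ 2 + z.im ^ 2) := (PF.re.pow 2).add (PF.im.pow 2)
  exact (((PF.const 4 27).sub (n2.pow 2)).add (((((PF.re.pow 3).sub ((PF.re.mul (PF.im.pow 2)).smul 3)).smul 8)).mono
    (by norm_num))).sub ((n2.smul 18).mono (by norm_num))

lemma Del_complex (z : ℂ) : (Del z : ℂ) = 27 - (z * (starRingEnd ℂ) z) ^ 2 + 4 * z ^ 3 + 4 * ((starRingEnd ℂ) z) ^ 3
    - 18 * (z * (starRingEnd ℂ) z) := by
  obtain ⟨a, b⟩ := z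
  have e1 : (⟨a, b⟩ : ℂ) = a + b * Complex.I := Complex.mk_eq_add_mul_I a b
  have e2 : (starRingEnd ℂ) (⟨a, b⟩ : ℂ) = a - b * Complex.I := by
    rw [e1]; simp [sub_eq_add_neg]
  rw [e2, Del]
  simp only
  rw [e1]
  push_cast
  have h := Complex.I_sq
  have h2 : Complex.I ^ 4 = 1 := Complex.I_pow_four
  linear_combination (-2 * a ^ 2 * b ^ 2 - 24 * a * b ^ 2 - 18 * b ^ 2 : ℂ) * h + (b ^ 4 : ℂ) * h2

lemma Del_rep {z x y u : ℂ} (h : Rep3 z x y u) : (Del z : ℂ) = - ((x - y) * (y - u) * (u - x)) ^ 2 := by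
  rw [Del_complex, ← h.s2, ← h.s1]
  have e : ∀ s1 s2 s3 : ℂ, s1 = x + y + u → s2 = x * y + y * u + u * x → s3 = x * y * u →
      ((x - y) * (y - u) * (u - x)) ^ 2 = s1 ^ 2 * s2 ^ 2 - 4 * s2 ^ 3 - 4 * s1 ^ 3 * s3 + 18 * s1 * s2 * s3
        - 27 * s3 ^ 2 := by
    rintro _ _ _ rfl rfl rfl; ring
  rw [e _ _ _ rfl rfl rfl, h.s3]; ring

lemma ex_sub_sq (a b : ℝ) : (ex a - ex b) ^ 2 = - ((4 * Real.sin ((a - b) / 2) ^ 2 : ℝ) : ℂ) * (ex a * ex b) := by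
  rw [Real.sin_sq_eq_half_sub, show 2 * ((a - b) / 2) = a - b by ring]
  have e : ((Real.cos (a - b) : ℝ) : ℂ) * 2 = ex (a - b) + ex (- (a - b)) := by
    rw [ex, ex]; push_cast; rw [Complex.cos]; ring
  rw [sub_eq_add_neg a b, neg_add, neg_neg, ex_add, ex_add, ex_neg, ex_neg, ← sub_eq_add_neg] at e
  have na := ex_ne a
  have nb := ex_ne b
  field_simp at e
  push_cast at e ⊢
  linear_combination -e

lemma Del_zt {θ : Fin 3 → ℝ} (h : θ ∈ HH) : Del (zt θ) = 64 * (Real.sin ((θ 0 - θ 1) / 2) ^ 2 *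
    Real.sin ((θ 1 - θ 2) / 2) ^ 2 * Real.sin ((θ 2 - θ 0) / 2) ^ 2) := by
  have h1 := Del_rep (zt_rep h)
  rw [mul_pow, mul_pow, ex_sub_sq, ex_sub_sq, ex_sub_sq] at h1
  have h3 := (zt_rep h).s3
  have : (Del (zt θ) : ℂ) = ((64 * (Real.sin ((θ 0 - θ 1) / 2) ^ 2 *
    Real.sin ((θ 1 - θ 2) / 2) ^ 2 * Real.sin ((θ 2 - θ 0) / 2) ^ 2) : ℝ) : ℂ) := by
    rw [h1]
    push_cast
    generalize (Complex.sin ((θ 0 - θ 1) / 2)) = A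
    generalize (Complex.sin ((θ 1 - θ 2) / 2)) = B
    generalize (Complex.sin ((θ 2 - θ 0) / 2)) = C
    generalize ex (θ 0) = x at *
    generalize ex (θ 1) = y at *
    generalize ex (θ 2) = u at *
    linear_combination (64 * A ^ 2 * B ^ 2 * C ^ 2) * (x * y * u + 1) * h3
  exact_mod_cast this

lemma Del_outside {z x y u : ℂ} (h : Rep3 z x y u) (hx : 1 < ‖x‖) (hy : y * (starRingEnd ℂ) x = 1)
    (hu : u * x = (starRingEnd ℂ) x) : Del z ≤ 0 := by
  have x0 : x ≠ 0 := by rintro rfl; simp at hx; linarith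
  have c0 : (starRingEnd ℂ) x ≠ 0 := by simpa using x0
  have h1 := Del_rep h
  have ey : y = 1 / (starRingEnd ℂ) x := by field_simp; exact hy
  have eu : u = (starRingEnd ℂ) x / x := by field_simp; exact hu
  have e : (x - y) * (y - u) * (u - x) = (((Complex.normSq x - 1) * Complex.normSq (x - (starRingEnd ℂ) x ^ 2) / Complex.normSq x ^ 2 : ℝ) : ℂ) := by
    push_cast
    rw [← Complex.mul_conj, ← Complex.mul_conj, ey, eu]
    simp only [map_sub, map_pow, Complex.conj_conj]
    field_simp
  rw [e] at h1
  have : Del z = - ((Complex.normSq x - 1) * Complex.normSq (x - (starRingEnd ℂ) x ^ 2) / Complex.normSq x ^ 2) ^ 2 := by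
    exact_mod_cast h1
  rw [this]
  have := sq_nonneg ((Complex.normSq x - 1) * Complex.normSq (x - (starRingEnd ℂ) x ^ 2) / Complex.normSq x ^ 2)
  linarith

noncomputable def Vf (β : ℝ) (z : ℂ) : ℝ := 1 + β + (-1 / 64) * Del z

lemma Vf_PF (β : ℝ) : PF 4 (Vf β) := (PF.const 4 _).add (Del_PF.smul _)

lemma Vf_ge {β : ℝ} {θ : Fin 3 → ℝ} (h : θ ∈ HH) : β ≤ Vf β (zt θ) := by
  rw [Vf, Del_zt h]
  have a := Real.sin_sq_le_one ((θ 0 - θ 1) / 2)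
  have b := Real.sin_sq_le_one ((θ 1 - θ 2) / 2)
  have c := Real.sin_sq_le_one ((θ 2 - θ 0) / 2)
  have := mul_le_one₀ (mul_le_one₀ a (sq_nonneg _) b) (sq_nonneg _) c
  linarith

/-- bulk -/
def Bulk (δ : ℝ) : Set (Fin 3 → ℝ) := {θ | θ ∈ HH ∧ δ ≤ |Real.sin ((θ 0 - θ 1) / 2)| ∧
  δ ≤ |Real.sin ((θ 1 - θ 2) / 2)| ∧ δ ≤ |Real.sin ((θ 2 - θ 0) / 2)|}

lemma Vf_bulk {δ : ℝ} (hδ : 0 < δ) {θ : Fin 3 → ℝ} (h : θ ∈ Bulk δ) : Vf (δ ^ 6 / 2) (zt θ) ≤ 1 - δ ^ 6 / 2 := by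
  obtain ⟨h0, a, b, c⟩ := h
  rw [Vf, Del_zt h0]
  have a' := pow_le_pow_left₀ hδ.le a 2
  have b' := pow_le_pow_left₀ hδ.le b 2
  have c' := pow_le_pow_left₀ hδ.le c 2
  rw [sq_abs] at a' b' c'
  have := mul_le_mul (mul_le_mul a' b' (by positivity) (by positivity)) c' (by positivity) (by positivity)
  have e : δ ^ 2 * δ ^ 2 * δ ^ 2 = δ ^ 6 := by ring
  rw [e] at this
  linarith

lemma zt_re (θ : Fin 3 → ℝ) : (zt θ).re = Real.cos (θ 0) + Real.cos (θ 1) + Real.cos (θ 2) := by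
  simp only [zt, Complex.add_re, ex_re]
lemma zt_im (θ : Fin 3 → ℝ) : (zt θ).im = Real.sin (θ 0) + Real.sin (θ 1) + Real.sin (θ 2) := by
  simp only [zt, Complex.add_im, ex_im]

lemma Bd_cos1 (S : Set (Fin 3 → ℝ)) (i : Fin 3) (k : ℕ) (φ : ℝ) :
    Bd S 1 k (fun θ => Real.cos (k * θ i + φ)) := by
  refine Bd.cos_lin (fun θ : Fin 3 → ℝ => (k : ℝ) * θ i) ?_ ?_ (by positivity) ?_ _
  · intro x y; simp; ring
  · intro x; simp
  · intro v
    have h1 := norm_le_pi_norm v i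
    rw [Real.norm_eq_abs] at h1
    rw [abs_mul, Nat.abs_cast]
    gcongr

lemma Bd_cosk (S : Set (Fin 3 → ℝ)) (k : ℕ) (φ : ℝ) :
    Bd S 3 k (fun θ => Real.cos (k * θ 0 + φ) + Real.cos (k * θ 1 + φ) + Real.cos (k * θ 2 + φ)) :=
  (((Bd_cos1 S 0 k φ).add (Bd_cos1 S 1 k φ)).add (Bd_cos1 S 2 k φ)).mono (by norm_num) le_rfl

lemma Tk_re (k : ℕ) {θ : Fin 3 → ℝ} (h : θ ∈ HH) : (Tch k (zt θ)).re =
    Real.cos (k * θ 0 + 0) + Real.cos (k * θ 1 + 0) + Real.cos (k * θ 2 + 0) := by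
  rw [Tch_rep (zt_rep h), ← ex_nat, ← ex_nat, ← ex_nat]
  simp only [Complex.add_re, ex_re, add_zero]

lemma Tk_im (k : ℕ) {θ : Fin 3 → ℝ} (h : θ ∈ HH) : (Tch k (zt θ)).im =
    Real.cos (k * θ 0 + - (Real.pi / 2)) + Real.cos (k * θ 1 + - (Real.pi / 2)) + Real.cos (k * θ 2 + - (Real.pi / 2)) := by
  rw [Tch_rep (zt_rep h), ← ex_nat, ← ex_nat, ← ex_nat]
  simp only [Complex.add_im, ex_im, ← sub_eq_add_neg, Real.cos_sub_pi_div_two]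

lemma Bd_Tre (k : ℕ) : Bd HH 3 k (fun θ => (Tch k (zt θ)).re) := (Bd_cosk HH k 0).congr fun _ h => Tk_re k h
lemma Bd_Tim (k : ℕ) : Bd HH 3 k (fun θ => (Tch k (zt θ)).im) := (Bd_cosk HH k _).congr fun _ h => Tk_im k h

lemma Bd_re : Bd HH 3 1 (fun θ => (zt θ).re) := by
  have := Bd_Tre 1
  simpa [Tch] using this
lemma Bd_im : Bd HH 3 1 (fun θ => (zt θ).im) := by
  have := Bd_Tim 1
  simpa [Tch] using this

lemma Bd_nT (k : ℕ) : Bd HH 19 (2 * k) (fun θ => 1 + ((Tch k (zt θ)).re ^ 2 + (Tch k (zt θ)).im ^ 2)) := by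
  have h1 := ((Bd_Tre k).pow 2).add ((Bd_Tim k).pow 2)
  have h2 := ((Bd.const (S := HH) (c := 1)).mono le_rfl (by positivity : (0:ℝ) ≤ ((2:ℕ):ℝ) * k)).add h1
  exact h2.mono (by norm_num) (by push_cast; exact le_rfl)

lemma Bd_V {β : ℝ} (hβ : 0 ≤ β) (hβ1 : β ≤ 1) : Bd HH 60 4 (fun θ => Vf β (zt θ)) := by
  have n2 : Bd HH 18 2 (fun θ => (zt θ).re ^ 2 + (zt θ).im ^ 2) :=
    ((Bd_re.pow 2).add (Bd_im.pow 2)).mono (by norm_num) (by norm_num)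
  have n4 := (n2.pow 2).smul (-1)
  have a1 : Bd HH 27 4 (fun θ => (zt θ).re ^ 3) := (Bd_re.pow 3).mono (by norm_num) (by norm_num)
  have a2 := (Bd_re.mul (Bd_im.pow 2)).smul (-3)
  have a3 := (a1.add (a2.mono le_rfl (by norm_num))).smul 8
  have a4 := (n2.mono le_rfl (by norm_num : (2:ℝ) ≤ 4)).smul (-18)
  have c0 := (Bd.const (S := HH) (c := 27)).mono le_rfl (by norm_num : (0:ℝ) ≤ 4)
  have c1 := (Bd.const (S := HH) (c := 1 + β)).mono le_rfl (by norm_num : (0:ℝ) ≤ 4)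
  have t := c1.add ((((c0.add (n4.mono le_rfl (by norm_num))).add a3).add a4).smul (-1 / 64))
  refine (t.mono ?_ le_rfl).congr fun θ _ => ?_
  · rw [abs_of_nonneg (by linarith : 0 ≤ 1 + β)]
    norm_num [abs_of_nonneg, abs_of_neg]
    linarith
  · simp only [Vf, Del]; ring

noncomputable def ME (K : ℕ) : ℝ := ∏ j ∈ Finset.range K, (9 + ((j : ℝ) + 1) * 9)

lemma ME_pos (K : ℕ) : 0 < ME K := Finset.prod_pos fun j _ => by positivity

lemma Bd_E (K : ℕ) : Bd HH (ME K) (2 * K) (fun θ => Efun K (zt θ)) := by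
  have h := Bd.prod (S := HH) (Finset.range K) (M := fun j => (9 + ((j : ℝ) + 1) * 9)) (L := fun _ => 2)
    (f := fun j θ => (zt θ).re ^ 2 + ((j : ℝ) + 1) * (zt θ).im ^ 2) (fun j _ => by
      have := (Bd_re.pow 2).add ((Bd_im.pow 2).smul ((j : ℝ) + 1))
      refine this.mono (le_of_eq ?_) (by norm_num)
      rw [abs_of_nonneg (by positivity)]; norm_num)
  refine (h.mono le_rfl (le_of_eq ?_)).congr fun θ _ => rfl
  simp; ring

lemma Efun_nonneg (K : ℕ) (z : ℂ) : 0 ≤ Efun K z := Finset.prod_nonneg fun j _ => by positivity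

noncomputable def Rf (K k m : ℕ) (β : ℝ) (z : ℂ) : ℝ :=
  (Vf β z ^ m * (1 + ((Tch k z).re ^ 2 + (Tch k z).im ^ 2)) + (1 - β) ^ m) + (1 - β) ^ m / ME K * Efun K z

lemma Rf_PF (k m : ℕ) (β : ℝ) : PF (4 * m + 2 * k) (fun z => Vf β z ^ m * (1 + ((Tch k z).re ^ 2 + (Tch k z).im ^ 2)) + (1 - β) ^ m) := by
  have h1 : PF (2 * k) (fun z => (1 + ((Tch k z).re ^ 2 + (Tch k z).im ^ 2))) := by
    have := (PF.const (k * 2) 1).add (((Tch_CPF k).1.pow 2).add ((Tch_CPF k).2.pow 2))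
    rw [mul_comm]; exact this
  exact (((Vf_PF β).pow m).mul h1).add (PF.const _ _)

lemma Rf_ge (K k m : ℕ) {β : ℝ} (hβ : 0 ≤ β) (hβ1 : β ≤ 1) {θ : Fin 3 → ℝ} (h : θ ∈ HH) :
    (1 - β) ^ m ≤ Rf K k m β (zt θ) := by
  unfold Rf
  have h1 : 0 ≤ Vf β (zt θ) := hβ.trans (Vf_ge h)
  have h2 : 0 ≤ (1 - β) ^ m / ME K * Efun K (zt θ) :=
    mul_nonneg (div_nonneg (pow_nonneg (by linarith) _) (ME_pos K).le) (Efun_nonneg _ _)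
  have h3 : 0 ≤ Vf β (zt θ) ^ m * (1 + ((Tch k (zt θ)).re ^ 2 + (Tch k (zt θ)).im ^ 2)) := by positivity
  linarith

lemma Rf_Bd (K k m : ℕ) (hkK : k ≤ K) {δ : ℝ} (hδ : 0 < δ) (hδ1 : δ ≤ 1) :
    Bd (Bulk δ) (21 * (1 - δ ^ 6 / 2) ^ m) (480 * m + 2 * K) (fun θ => Rf K k m (δ ^ 6 / 2) (zt θ)) := by
  have d6 : δ ^ 6 ≤ 1 := pow_le_one₀ hδ.le hδ1
  have d60 : 0 < δ ^ 6 := by positivity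
  have hsub : Bulk δ ⊆ HH := fun θ h => h.1
  set β := δ ^ 6 / 2 with hβ
  have hq : 1 / 2 ≤ 1 - β := by linarith
  have q0 : 0 < 1 - β := by linarith
  have qm : 0 < (1 - β) ^ m := pow_pos q0 m
  have hV := ((Bd_V (β := β) (by positivity) (by linarith)).subset hsub).improve q0 (by linarith) (fun θ h => by
    rw [abs_le]
    have := Vf_ge (β := β) h.1
    exact ⟨by linarith, Vf_bulk hδ h⟩)
  have hV2 := hV.mono (le_refl _) (L' := 480) (by
    rw [div_le_iff₀ q0]; nlinarith)
  have hkK' : (k : ℝ) ≤ K := by exact_mod_cast hkK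
  have h1 := (hV2.pow m).mul ((Bd_nT k).subset hsub)
  have h2 := (Bd.const (S := Bulk δ) (c := (1 - β) ^ m)).mono (M' := (1 - β) ^ m) (le_of_eq (abs_of_pos qm)) (by positivity : (0:ℝ) ≤ 480 * m + 2 * K)
  have h3 := ((Bd_E K).subset hsub).smul ((1 - β) ^ m / ME K)
  have h4 := (((h1.mono le_rfl (by linarith : _ ≤ 480 * (m:ℝ) + 2 * K))).add h2).add (h3.mono le_rfl (by
    have : (0:ℝ) ≤ m := by positivity
    linarith : (2 * (K:ℝ)) ≤ 480 * (m:ℝ) + 2 * K))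
  refine (h4.mono ?_ le_rfl).congr fun θ _ => rfl
  rw [abs_of_pos (div_pos qm (ME_pos K)), div_mul_cancel₀ _ (ME_pos K).ne']
  linarith

lemma outside_bounds (K k m : ℕ) {β : ℝ} (hβ : 0 ≤ β) (hβ1 : β ≤ 1) {z x y u : ℂ} (h : Rep3 z x y u) (hx : 1 < ‖x‖)
    (hy : y * (starRingEnd ℂ) x = 1) (hu : u * x = (starRingEnd ℂ) x) :
    ‖y‖ ≤ 1 ∧ ‖u‖ ≤ 1 ∧ - 2 * ‖x‖ ^ (2 * k) ≤ Gf k z ∧ (1 + β) ^ m * (‖x‖ ^ (2 * k) / 5) ≤ Rf K k m β z := by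
  have ny : ‖y‖ * ‖x‖ = 1 := by
    have := congrArg norm hy
    rwa [norm_mul, RCLike.norm_conj, norm_one] at this
  have nu : ‖u‖ * ‖x‖ = ‖x‖ := by
    have := congrArg norm hu
    rwa [norm_mul, RCLike.norm_conj] at this
  have hy1 : ‖y‖ ≤ 1 := by nlinarith [norm_nonneg y]
  have hu1 : ‖u‖ ≤ 1 := by
    by_contra hc
    push Not at hc
    nlinarith
  have pown : ∀ n, ‖y ^ n‖ ≤ 1 ∧ ‖u ^ n‖ ≤ 1 := fun n => by
    rw [norm_pow, norm_pow]
    exact ⟨pow_le_one₀ (norm_nonneg _) hy1, pow_le_one₀ (norm_nonneg _) hu1⟩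
  refine ⟨hy1, hu1, ?_, ?_⟩
  · rw [Gf, Tch_rep h]
    have h1 : 1 ≤ ‖x‖ ^ (2 * k) := one_le_pow₀ hx.le
    have a := (abs_le.1 (Complex.abs_re_le_norm (x ^ (2 * k)))).1
    have b := (abs_le.1 (Complex.abs_re_le_norm (y ^ (2 * k)))).1
    have c := (abs_le.1 (Complex.abs_re_le_norm (u ^ (2 * k)))).1
    have := pown (2 * k)
    rw [norm_pow] at a
    simp only [Complex.add_re]
    linarith [this.1, this.2]
  · have hV : 1 + β ≤ Vf β z := by
      have := Del_outside h hx hy hu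
      rw [Vf]; linarith
    have hT : ‖x‖ ^ (2 * k) / 5 ≤ 1 + ((Tch k z).re ^ 2 + (Tch k z).im ^ 2) := by
      have e : (Tch k z).re ^ 2 + (Tch k z).im ^ 2 = ‖Tch k z‖ ^ 2 := by
        rw [← Complex.normSq_eq_norm_sq, Complex.normSq_apply]; ring
      rw [e, pow_mul, show (‖x‖ ^ 2) ^ k = (‖x‖ ^ k) ^ 2 by rw [← pow_mul, ← pow_mul, mul_comm]]
      set t := ‖x‖ ^ k
      have t1 : 1 ≤ t := one_le_pow₀ hx.le
      have hTn : t - 2 ≤ ‖Tch k z‖ := by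
        rw [Tch_rep h]
        have h1 : ‖x ^ k‖ = t := norm_pow _ _
        have h2 := norm_add_le_of_le (norm_add_le (x ^ k + y ^ k + u ^ k) (-(y ^ k))) (le_refl ‖-(u ^ k)‖)
        rw [show x ^ k + y ^ k + u ^ k + -(y ^ k) + -(u ^ k) = x ^ k by ring, h1, norm_neg, norm_neg] at h2
        linarith [(pown k).1, (pown k).2]
      rcases le_total t 2 with h2 | h2
      · nlinarith [sq_nonneg ‖Tch k z‖]
      · have : (t - 2) ^ 2 ≤ ‖Tch k z‖ ^ 2 := pow_le_pow_left₀ (by linarith) hTn 2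
        nlinarith [sq_nonneg (2 * t - 5)]
    have h2 : 0 ≤ (1 - β) ^ m / ME K * Efun K z :=
      mul_nonneg (div_nonneg (pow_nonneg (by linarith) _) (ME_pos K).le) (Efun_nonneg _ _)
    have h3 : 0 ≤ (1 - β) ^ m := pow_nonneg (by linarith) _
    have h4 : (1 + β) ^ m * (‖x‖ ^ (2 * k) / 5) ≤ Vf β z ^ m * (1 + ((Tch k z).re ^ 2 + (Tch k z).im ^ 2)) := by
      have hv := pow_le_pow_left₀ (by linarith) hV m
      exact mul_le_mul hv hT (by positivity) ((pow_nonneg (by linarith) _).trans hv)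
    unfold Rf
    linarith


lemma two_roots {y u y' u' : ℂ} (h1 : y + u = y' + u') (h2 : y * u = y' * u') :
    (y = y' ∧ u = u') ∨ (y = u' ∧ u = y') := by
  have : (y - y') * (y - u') = 0 := by linear_combination y * h1 - h2
  rcases mul_eq_zero.1 this with h | h
  · have h := sub_eq_zero.1 h
    subst h
    exact Or.inl ⟨rfl, add_left_cancel h1⟩
  · have h := sub_eq_zero.1 h
    subst h
    exact Or.inr ⟨rfl, by linear_combination h1⟩

lemma three_roots {z x y u x' y' u' : ℂ} (h : Rep3 z x y u) (h' : Rep3 z x' y' u') :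
    (x = x' ∧ y = y' ∧ u = u') ∨ (x = x' ∧ y = u' ∧ u = y') ∨ (x = y' ∧ y = x' ∧ u = u') ∨
    (x = y' ∧ y = u' ∧ u = x') ∨ (x = u' ∧ y = x' ∧ u = y') ∨ (x = u' ∧ y = y' ∧ u = x') := by
  have s1 := h.s1.trans h'.s1.symm
  have s2 := h.s2.trans h'.s2.symm
  have s3 := h.s3.trans h'.s3.symm
  have x0 : x ≠ 0 := by rintro rfl; have := h.s3; simp at this
  have : (x - x') * ((x - y') * (x - u')) = 0 := by
    linear_combination x ^ 2 * s1 - x * s2 + s3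
  rcases mul_eq_zero.1 this with e | e
  · have e := sub_eq_zero.1 e
    subst e
    rcases two_roots (y := y) (u := u) (y' := y') (u' := u') (by linear_combination s1)
      (mul_left_cancel₀ x0 (by linear_combination s3)) with ⟨a, b⟩ | ⟨a, b⟩
    · exact Or.inl ⟨rfl, a, b⟩
    · exact Or.inr (Or.inl ⟨rfl, a, b⟩)
  · rcases mul_eq_zero.1 e with e | e
    · have e := sub_eq_zero.1 e
      subst e
      rcases two_roots (y := y) (u := u) (y' := x') (u' := u') (by linear_combination s1)
        (mul_left_cancel₀ x0 (by linear_combination s3)) with ⟨a, b⟩ | ⟨a, b⟩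
      · exact Or.inr (Or.inr (Or.inl ⟨rfl, a, b⟩))
      · exact Or.inr (Or.inr (Or.inr (Or.inl ⟨rfl, a, b⟩)))
    · have e := sub_eq_zero.1 e
      subst e
      rcases two_roots (y := y) (u := u) (y' := x') (u' := y') (by linear_combination s1)
        (mul_left_cancel₀ x0 (by linear_combination s3)) with ⟨a, b⟩ | ⟨a, b⟩
      · exact Or.inr (Or.inr (Or.inr (Or.inr (Or.inl ⟨rfl, a, b⟩))))
      · exact Or.inr (Or.inr (Or.inr (Or.inr (Or.inr ⟨rfl, a, b⟩))))

lemma exists_perm {p q : Fin 3 → ℝ} (hp : p ∈ HH) (hq : q ∈ HH) (h : zt p = zt q) :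
    ∃ σ : Equiv.Perm (Fin 3), ∀ i, ex (p i) = ex (q (σ i)) := by
  have hp' := zt_rep hp
  rw [h] at hp'
  have T : ∀ (f : Fin 3 → Fin 3), Function.Bijective f → ex (p 0) = ex (q (f 0)) → ex (p 1) = ex (q (f 1)) →
      ex (p 2) = ex (q (f 2)) → ∃ σ : Equiv.Perm (Fin 3), ∀ i, ex (p i) = ex (q (σ i)) := by
    intro f hf h0 h1 h2
    refine ⟨Equiv.ofBijective f hf, fun i => ?_⟩
    rw [Equiv.ofBijective_apply]
    fin_cases i
    · exact h0
    · exact h1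
    · exact h2
  rcases three_roots hp' (zt_rep hq) with ⟨a, b, c⟩ | ⟨a, b, c⟩ | ⟨a, b, c⟩ | ⟨a, b, c⟩ | ⟨a, b, c⟩ | ⟨a, b, c⟩
  · exact T ![0, 1, 2] (by decide) a b c
  · exact T ![0, 2, 1] (by decide) a b c
  · exact T ![1, 0, 2] (by decide) a b c
  · exact T ![1, 2, 0] (by decide) a b c
  · exact T ![2, 0, 1] (by decide) a b c
  · exact T ![2, 1, 0] (by decide) a b c

lemma zt_sum (θ : Fin 3 → ℝ) : zt θ = ∑ i, ex (θ i) := by rw [Fin.sum_univ_three, zt]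

lemma transport {p q θ : Fin 3 → ℝ} (hp : p ∈ HH) (hq : q ∈ HH) (hθ : θ ∈ HH) (h : zt p = zt q) {ρ : ℝ}
    (hρ : 0 ≤ ρ) (hd : ‖θ - q‖ ≤ ρ) : ∃ θ' ∈ HH, zt θ' = zt θ ∧ ‖θ' - p‖ ≤ ρ := by
  obtain ⟨σ, hσ⟩ := exists_perm hp hq h
  have sumHH : ∀ η : Fin 3 → ℝ, η ∈ HH ↔ ∑ i, η i = 0 := fun η => by rw [Fin.sum_univ_three]; rfl
  refine ⟨fun i => θ (σ i) - (q (σ i) - p i), ?_, ?_, ?_⟩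
  · rw [sumHH] at *
    rw [Finset.sum_sub_distrib, Finset.sum_sub_distrib, Equiv.sum_comp σ θ, Equiv.sum_comp σ q, hp, hq, hθ]
    ring
  · rw [zt_sum, zt_sum, ← Equiv.sum_comp σ (fun i => ex (θ i))]
    refine Finset.sum_congr rfl fun i _ => ?_
    rw [show θ (σ i) - (q (σ i) - p i) = θ (σ i) + (- q (σ i) + p i) by ring, ex_add, ex_add, hσ, ← ex_add]
    simp [ex_zero]
  · refine (pi_norm_le_iff_of_nonneg hρ).2 fun i => ?_
    have := (norm_le_pi_norm (θ - q) (σ i)).trans hd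
    simp only [Pi.sub_apply] at this ⊢
    rw [show θ (σ i) - (q (σ i) - p i) - p i = θ (σ i) - q (σ i) by ring]
    exact this

lemma HH_closed : IsClosed HH := by
  apply isClosed_eq <;> fun_prop

set_option maxHeartbeats 2000000 in
theorem main_constr (K k m N : ℕ) (δ ρ : ℝ) (p : Fin N → Fin 3 → ℝ) (hk : 1 ≤ k) (hkK : k ≤ K)
    (hdeg : 4 * m + 2 * k ≤ 2 * K - 1) (hδ : 0 < δ) (hδ1 : δ ≤ 1) (hρ : 0 < ρ)
    (hnode : ∀ i, Node k (p i)) (hcos : ∀ i j, Real.cos (2 * k * p i j) = - (1 / 2))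
    (hdist : ∀ i j, i ≠ j → zt (p i) ≠ zt (p j))
    (hreg : ∀ i, ex (p i 0) ≠ ex (p i 1) ∧ ex (p i 1) ≠ ex (p i 2) ∧ ex (p i 0) ≠ ex (p i 2))
    (hbulk : ∀ i, ∀ θ ∈ HH, ‖θ - p i‖ ≤ ρ → θ ∈ Bulk δ)
    (hρ1 : N * (24 * k * ρ) ≤ 1 / 50) (hρ2 : 2 * k * ρ ≤ 1 / 4) (q : ℝ) (hq : q = (1 - δ ^ 6 / 2) ^ m)
    (hG : N * (42 * q * 6) < (2 * k * ρ) ^ 2 / 400)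
    (hout : 2 + N * (42 * q * 6) < (1 + δ ^ 6 / 2) ^ m / 5)
    (hsec : 21 * q * (480 * m + 2 * K) ^ 2 + N * (42 * q * (6 * (4 * k) ^ 2)) < (k : ℝ) ^ 2 / 4) :
    ∃ P : MvPolynomial (Fin 3) ℝ, P ≠ 0 ∧ P.IsHomogeneous (2 * K) ∧
      Squarefree (MvPolynomial.map (algebraMap ℝ ℂ) P) ∧ (RZ P).Finite ∧ (RZ P).ncard = N := by
  classical
  have d6 : δ ^ 6 ≤ 1 := pow_le_one₀ hδ.le hδ1
  have d60 : 0 < δ ^ 6 := by positivity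
  set β := δ ^ 6 / 2 with hβ
  have β0 : 0 ≤ β := by positivity
  have β1 : β ≤ 1 := by linarith
  have q0 : 0 < q := by rw [hq]; exact pow_pos (by linarith) _
  have k0 : (0:ℝ) < k := by positivity
  have hgd := fun i => (hnode i).sum0
  let U : Fin N → Set (Fin 3 → ℝ) := fun i => {θ | θ ∈ HH ∧ ‖θ - p i‖ ≤ ρ}
  let P0 : ℂ → ℝ := fun z => Gf k z + Rf K k m β z
  have hRB := Rf_Bd K k m hkK hδ hδ1
  rw [← hβ, ← hq] at hRB
  have hpU : ∀ i, p i ∈ U i := fun i => ⟨hgd i, by simp [hρ.le]⟩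
  have Gp : ∀ i, Gf k (zt (p i)) = 0 := fun i => by
    rw [Gf_zt k (hgd i), hcos, hcos, hcos]; norm_num
  have Qlip : ∀ i, ∀ a ∈ HH, ∀ b ∈ HH, ‖a - b‖ ≤ ρ → |Qp k (p i) (zt a) - Qp k (p i) (zt b)| ≤ 24 * k * ρ := by
    intro i a ha b hb hab
    refine ((Qp_Bd k hk (p i)).lip a ha b hb).trans ?_
    have : (0:ℝ) ≤ 6 * (4 * k) := by positivity
    calc _ ≤ 6 * (4 * (k:ℝ)) * ρ := by gcongr
      _ = _ := by ring
  have Qδ : ∀ i j, ∀ a ∈ U i, |Qp k (p j) (zt a) - (if j = i then 1 else 0)| ≤ 24 * k * ρ := by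
    intro i j a ha
    have h1 := Qlip j a ha.1 (p i) (hgd i) ha.2
    have h2 : Qp k (p j) (zt (p i)) = if j = i then 1 else 0 := by
      split_ifs with h
      · subst h
        exact Qp_node_self k hk (hnode j) (hreg j).1 (hreg j).2.1 (hreg j).2.2
      · exact Qp_node_ne k (hnode j) (hnode i) (hdist i j (Ne.symm h))
    rwa [h2] at h1
  have hRPF := Rf_PF k m β
  obtain ⟨c, hc, hmin⟩ := abstract_min U
    (fun i => by
      refine Metric.isCompact_of_isClosed_isBounded ?_ ?_
      · have hcl : IsClosed {θ : Fin 3 → ℝ | ‖θ - p i‖ ≤ ρ} := isClosed_le (by fun_prop) continuous_const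
        exact HH_closed.inter hcl
      · refine (Metric.isBounded_closedBall (x := p i) (r := ρ)).subset fun θ h => ?_
        rw [Metric.mem_closedBall, dist_eq_norm]; exact h.2)
    (fun i => ⟨p i, hpU i⟩) (fun θ => P0 (zt θ))
    (by
      have c1 := (Gf_PF k).continuous
      have c2 := hRPF.continuous
      have c3 : Continuous (Efun K) := by unfold Efun; fun_prop
      have : Continuous P0 := by
        simp only [P0, Rf]
        exact c1.add (c2.add (continuous_const.mul c3))
      exact this.comp zt_continuous)
    (fun i θ => Qp k (p i) (zt θ)) (fun i => (Qp_PF k (p i)).continuous.comp zt_continuous)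
    (24 * k * ρ) Qδ (by rw [Fintype.card_fin]; linarith) (21 * q) (by positivity)
    (fun i a ha => by
      have h1 := Gf_nonneg k ha.1
      have h2 := Rf_ge K k m β0 β1 ha.1
      rw [← hq] at h2
      simp only [P0]; linarith)
    (fun i => ⟨p i, hpU i, by
      have := (abs_le.1 (hRB.bd (p i) (hbulk i _ (hgd i) (by simp [hρ.le])))).2
      simp only [P0, Gp]; linarith⟩)
  choose hpos a haU ha0 using hmin
  let F : ℂ → ℝ := fun z => P0 z - ∑ i, c i * Qp k (p i) z
  have Fdef : ∀ z, F z = P0 z - ∑ i, c i * Qp k (p i) z := fun z => rfl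
  have sumB : ∀ z X, (∀ i, |Qp k (p i) z| ≤ X) → |∑ i, c i * Qp k (p i) z| ≤ N * (42 * q * X) := by
    intro z X hX
    refine (Finset.abs_sum_le_sum_abs _ _).trans ?_
    refine (Finset.sum_le_sum (g := fun _ => 42 * q * X) fun i _ => ?_).trans (le_of_eq (by simp))
    rw [abs_mul]
    refine mul_le_mul ((hc i).trans (by linarith)) (hX i) (abs_nonneg _) (by positivity)
  -- uniqueness
  have uniq : ∀ i, ∀ b ∈ U i, F (zt b) = 0 → b = a i := by
    intro i b hb hb0
    have ha := haU i
    have ha' : F (zt (a i)) = 0 := ha0 i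
    set mm : Fin 3 → ℝ := (1/2 : ℝ) • (b + a i) with hmm
    set v : Fin 3 → ℝ := (1/2 : ℝ) • (b - a i) with hv
    have e1 : mm + v = b := by
      rw [hmm, hv]; ext j; simp; ring
    have e2 : mm - v = a i := by
      rw [hmm, hv]; ext j; simp; ring
    have mH : mm ∈ HH := by
      have h1 : b 0 + b 1 + b 2 = 0 := hb.1
      have h2 : a i 0 + a i 1 + a i 2 = 0 := ha.1
      change mm 0 + mm 1 + mm 2 = 0
      simp [hmm]; linarith
    have vn : ‖v‖ ≤ ρ := by
      rw [hv, norm_smul]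
      have : ‖b - a i‖ ≤ ρ + ρ := by
        rw [show b - a i = (b - p i) - (a i - p i) by abel]
        exact norm_sub_le_of_le hb.2 ha.2
      norm_num; linarith
    have mU : mm ∈ U i := by
      refine ⟨mH, ?_⟩
      rw [show mm - p i = (1/2 : ℝ) • ((b - p i) + (a i - p i)) by
        rw [hmm]; ext j; simp; ring, norm_smul]
      have := norm_add_le_of_le hb.2 ha.2
      norm_num; linarith
    have hGs := Gf_sec k hk mH (by rw [e1]; exact hb.1) (by rw [e2]; exact ha.1) (fun j => by
        have h1 := (Bd_cos1 Set.univ j (2 * k) 0).lip mm trivial (p i) trivial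
        push_cast at h1
        simp only [add_zero, hcos, one_mul] at h1
        have h2 : 2 * (k:ℝ) * ‖mm - p i‖ ≤ 1 / 4 := le_trans (by gcongr; exact mU.2) hρ2
        have := (abs_le.1 (h1.trans h2)).2
        linarith) (fun j => by
        have h1 := (norm_le_pi_norm v j).trans vn
        rw [Real.norm_eq_abs] at h1
        rw [abs_mul, abs_of_pos (by positivity : (0:ℝ) < 2 * k)]
        have h2 : 2 * (k:ℝ) * |v j| ≤ 1 / 4 := le_trans (by gcongr) hρ2
        have := Real.pi_gt_three
        linarith)
    have bk : ∀ θ ∈ U i, θ ∈ Bulk δ := fun θ h => hbulk i θ h.1 h.2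
    have hRs := hRB.sec mm v (bk _ mU) (by rw [e1]; exact bk _ hb) (by rw [e2]; exact bk _ ha)
    have hQs : |∑ j, c j * (Qp k (p j) (zt (mm + v)) + Qp k (p j) (zt (mm - v)) - 2 * Qp k (p j) (zt mm))| ≤
        N * (42 * q * (6 * (4 * k) ^ 2 * ‖v‖ ^ 2)) := by
      refine (Finset.abs_sum_le_sum_abs _ _).trans ?_
      refine (Finset.sum_le_sum (g := fun _ => 42 * q * (6 * (4 * k) ^ 2 * ‖v‖ ^ 2)) fun j _ => ?_).trans (le_of_eq (by simp))
      rw [abs_mul]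
      refine mul_le_mul ((hc j).trans (by linarith)) ?_ (abs_nonneg _) (by positivity)
      exact (Qp_Bd k hk (p j)).sec mm v mH (by rw [e1]; exact hb.1) (by rw [e2]; exact ha.1)
    have tot : F (zt (mm + v)) + F (zt (mm - v)) - 2 * F (zt mm) =
        (Gf k (zt (mm + v)) + Gf k (zt (mm - v)) - 2 * Gf k (zt mm)) +
        (Rf K k m β (zt (mm + v)) + Rf K k m β (zt (mm - v)) - 2 * Rf K k m β (zt mm)) -
        ∑ j, c j * (Qp k (p j) (zt (mm + v)) + Qp k (p j) (zt (mm - v)) - 2 * Qp k (p j) (zt mm)) := by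
      have : ∑ j, c j * (Qp k (p j) (zt (mm + v)) + Qp k (p j) (zt (mm - v)) - 2 * Qp k (p j) (zt mm)) =
          ∑ j, c j * Qp k (p j) (zt (mm + v)) + ∑ j, c j * Qp k (p j) (zt (mm - v)) - 2 * ∑ j, c j * Qp k (p j) (zt mm) := by
        rw [Finset.mul_sum, ← Finset.sum_add_distrib, ← Finset.sum_sub_distrib]
        refine Finset.sum_congr rfl fun j _ => by ring
      rw [this]
      simp only [Fdef, P0]; ring
    have hm0 : 0 ≤ F (zt mm) := hpos i mm mU
    rw [e1, e2, hb0, ha'] at tot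
    rw [e1, e2] at hGs hRs hQs
    have r1 := (abs_le.1 hRs).1
    have r2 := (abs_le.1 hQs).2
    have hv0 : ‖v‖ ^ 2 ≤ 0 := by
      by_contra hcon
      push Not at hcon
      have := mul_lt_mul_of_pos_right hsec hcon
      nlinarith
    have hv1 : v = 0 := by
      rw [← norm_eq_zero]; nlinarith [norm_nonneg v]
    rw [← e1, ← e2, hv1]; simp
  -- zero set
  have zeros : {z : ℂ | F z = 0} = Set.range (fun i => zt (a i)) := by
    ext z
    constructor
    · intro hz
      have hz : F z = 0 := hz
      rcases rep_cases z with ⟨θ, hθ, rfl⟩ | ⟨x, y, u, hr, hx, hy, hu⟩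
      · have e : ∑ i, Complex.exp (θ i * Complex.I) = zt θ := by rw [zt_sum]; rfl
        rw [e] at hz ⊢
        have hθ : θ ∈ HH := hθ
        have hR := Rf_ge K k m β0 β1 hθ
        rw [← hq] at hR
        by_cases hg : Gf k (zt θ) < (2 * k * ρ) ^ 2 / 400
        · obtain ⟨r, hr, hrθ⟩ := near_node k hk hθ ρ hρ (by linarith) hg
          by_cases hex : ∃ i, zt (p i) = zt r
          · obtain ⟨i, hi⟩ := hex
            obtain ⟨θ', h1, h2, h3⟩ := transport (hgd i) hr.sum0 hθ hi hρ.le hrθ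
            refine ⟨i, ?_⟩
            simp only
            rw [← uniq i θ' ⟨h1, h3⟩ (by rw [h2]; exact hz), h2]
          · push Not at hex
            exfalso
            have := sumB (zt θ) (24 * k * ρ) (fun i => by
              have h1 := Qlip i θ hθ r hr.sum0 hrθ
              rwa [Qp_node_ne k (hnode i) hr (Ne.symm (hex i)), sub_zero] at h1)
            have h1 := (abs_le.1 this).2
            have h2 := Gf_nonneg k hθ
            rw [Fdef] at hz
            simp only [P0] at hz
            nlinarith
        · exfalso
          have := sumB (zt θ) 6 (fun i => (Qp_Bd k hk (p i)).bd θ hθ)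
          have h1 := (abs_le.1 this).2
          rw [Fdef] at hz
          simp only [P0] at hz
          linarith
      · exfalso
        obtain ⟨hy1, hu1, hG1, hR1⟩ := outside_bounds K k m β0 β1 hr hx hy hu
        have := sumB z (6 * ‖x‖ ^ (2 * k)) (fun i => Qp_outside k hk (p i) hr hx.le hy1 hu1)
        have h1 := (abs_le.1 this).2
        rw [Fdef] at hz
        simp only [P0] at hz
        have hX : 0 < ‖x‖ ^ (2 * k) := by positivity
        have := mul_lt_mul_of_pos_right hout hX
        nlinarith
    · rintro ⟨i, rfl⟩
      exact ha0 i
  have inj : Function.Injective (fun i => zt (a i)) := by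
    intro i j hij
    by_contra hne
    simp only at hij
    have h1 := Qδ i i (a i) (haU i)
    have h2 := Qδ j i (a j) (haU j)
    rw [if_pos rfl, hij] at h1
    rw [if_neg hne] at h2
    have hN : (1:ℝ) ≤ N := by
      have : 0 < N := i.pos
      exact_mod_cast this
    have h3 : 24 * k * ρ ≤ 1 / 50 := by
      have : 0 ≤ 24 * k * ρ := by positivity
      nlinarith
    have := (abs_le.1 h1).1
    have := (abs_le.1 h2).2
    linarith
  have hs : 0 < q / ME K := div_pos q0 (ME_pos K)
  have hf0 : PF (2 * K - 1) (fun z => (Gf k z + (Vf β z ^ m * (1 + ((Tch k z).re ^ 2 + (Tch k z).im ^ 2)) + (1 - β) ^ m))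
      - ∑ i, c i * Qp k (p i) z) := by
    refine PF.sub (PF.add ((Gf_PF k).mono (by omega)) (hRPF.mono hdeg)) ?_
    exact PF.sum _ fun i _ => ((Qp_PF k (p i)).mono (by omega)).smul _
  have hFe : ∀ z, (Gf k z + (Vf β z ^ m * (1 + ((Tch k z).re ^ 2 + (Tch k z).im ^ 2)) + (1 - β) ^ m))
      - ∑ i, c i * Qp k (p i) z + q / ME K * Efun K z = F z := by
    intro z
    rw [Fdef, hq]; simp only [P0, Rf]; ring
  have := poly_final K (hk.trans hkK) _ hf0 (q / ME K) hs (by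
    simp only [hFe, zeros]; exact Set.finite_range _)
  obtain ⟨P, h1, h2, h3, h4, h5⟩ := this
  refine ⟨P, h1, h2, h3, h4, ?_⟩
  simp only [hFe, zeros] at h5
  rw [h5, ← Set.image_univ, Set.ncard_image_of_injective _ inj, Set.ncard_univ, Nat.card_eq_fintype_card, Fintype.card_fin]


lemma cos_third (a : ℤ) (h : a % 3 ≠ 0) : Real.cos (2 * Real.pi * (a / 3)) = - (1 / 2) := by
  have h3 := cos_two_pi_div_three
  have : a % 3 = 1 ∨ a % 3 = 2 := by omega
  rcases this with h | h
  · obtain ⟨b, hb⟩ : ∃ b : ℤ, a = 3 * b + 1 := ⟨a / 3, by omega⟩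
    rw [hb]
    push_cast
    rw [show 2 * Real.pi * ((3 * (b:ℝ) + 1) / 3) = 2 * Real.pi / 3 + b * (2 * Real.pi) by ring,
      Real.cos_add_int_mul_two_pi]
    linarith
  · obtain ⟨b, hb⟩ : ∃ b : ℤ, a = 3 * b - 1 := ⟨a / 3 + 1, by omega⟩
    rw [hb]
    push_cast
    rw [show 2 * Real.pi * ((3 * (b:ℝ) - 1) / 3) = - (2 * Real.pi / 3) + b * (2 * Real.pi) by ring,
      Real.cos_add_int_mul_two_pi, Real.cos_neg]
    linarith

lemma int_same {x y a b : ℝ} {n m : ℤ} (h1 : y < x) (h2 : x - y < 2 * Real.pi) (hx : x = a + n * (2 * Real.pi))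
    (hy : y = b + m * (2 * Real.pi)) (h3 : b < a) (h4 : a - b < 2 * Real.pi) : n = m := by
  have hp := Real.pi_pos
  have e : ((n:ℝ) - m) * (2 * Real.pi) = (x - y) - (a - b) := by rw [hx, hy]; ring
  have l1 : (n:ℝ) - m < 1 := by
    by_contra hc
    push Not at hc
    nlinarith
  have l2 : -1 < (n:ℝ) - m := by
    by_contra hc
    push Not at hc
    nlinarith
  have l1' : n - m < 1 := by exact_mod_cast l1
  have l2' : -1 < n - m := by exact_mod_cast l2
  omega

lemma int_flip {x y a b : ℝ} {n m : ℤ} (h1 : y < x) (h2 : x - y < 2 * Real.pi) (hx : x = a + n * (2 * Real.pi))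
    (hy : y = b + m * (2 * Real.pi)) (h3 : a < b) (h4 : b - a < 2 * Real.pi) : n = m + 1 := by
  have := int_same (n := n - 1) (m := m) h1 h2 (a := a + 2 * Real.pi) (by rw [hx]; push_cast; ring) hy (by linarith) (by linarith)
  omega

lemma alcove {p q : Fin 3 → ℝ} (hp : p ∈ HH) (hq : q ∈ HH) (h : zt p = zt q)
    (p1 : p 1 < p 0) (p2 : p 2 < p 1) (p3 : p 0 - p 2 < 2 * Real.pi)
    (q1 : q 1 < q 0) (q2 : q 2 < q 1) (q3 : q 0 - q 2 < 2 * Real.pi) :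
    p 0 = q 0 ∧ p 1 = q 1 ∧ p 2 = q 2 := by
  have hp' := zt_rep hp
  rw [h] at hp'
  have sp : p 0 + p 1 + p 2 = 0 := hp
  have sq : q 0 + q 1 + q 2 = 0 := hq
  have key : ∀ a b c : ℝ, a + b + c = 0 → ex (p 0) = ex a → ex (p 1) = ex b → ex (p 2) = ex c →
      ∃ n0 n1 n2 : ℤ, n0 + n1 + n2 = 0 ∧ p 0 = a + n0 * (2 * Real.pi) ∧ p 1 = b + n1 * (2 * Real.pi) ∧
        p 2 = c + n2 * (2 * Real.pi) := by
    intro a b c s h0 h1 h2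
    obtain ⟨n0, h0⟩ := (ex_eq_iff _ _).1 h0
    obtain ⟨n1, h1⟩ := (ex_eq_iff _ _).1 h1
    obtain ⟨n2, h2⟩ := (ex_eq_iff _ _).1 h2
    refine ⟨n0, n1, n2, ?_, h0, h1, h2⟩
    have : ((n0:ℝ) + n1 + n2) * (2 * Real.pi) = 0 := by linarith
    rcases mul_eq_zero.1 this with h | h
    · exact_mod_cast h
    · have := Real.pi_pos; linarith
  rcases three_roots hp' (zt_rep hq) with ⟨a, b, c⟩ | ⟨a, b, c⟩ | ⟨a, b, c⟩ | ⟨a, b, c⟩ | ⟨a, b, c⟩ | ⟨a, b, c⟩ <;>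
    obtain ⟨n0, n1, n2, hs, h0, h1, h2⟩ := key _ _ _ (by linarith) a b c
  · have e1 := int_same p1 (by linarith) h0 h1 q1 (by linarith)
    have e2 := int_same p2 (by linarith) h1 h2 q2 (by linarith)
    have z0 : n0 = 0 := by omega
    have z1 : n1 = 0 := by omega
    have z2 : n2 = 0 := by omega
    subst z0 z1 z2
    simp at h0 h1 h2
    exact ⟨h0, h1, h2⟩
  · have e1 := int_same p1 (by linarith) h0 h1 (by linarith) (by linarith)
    have e2 := int_flip p2 (by linarith) h1 h2 (by linarith) (by linarith)
    omega
  · have e1 := int_flip p1 (by linarith) h0 h1 (by linarith) (by linarith)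
    have e2 := int_same p2 (by linarith) h1 h2 (by linarith) (by linarith)
    omega
  · have e1 := int_same p1 (by linarith) h0 h1 (by linarith) (by linarith)
    have e2 := int_flip p2 (by linarith) h1 h2 (by linarith) (by linarith)
    omega
  · have e1 := int_flip p1 (by linarith) h0 h1 (by linarith) (by linarith)
    have e2 := int_same p2 (by linarith) h1 h2 (by linarith) (by linarith)
    omega
  · have e1 := int_flip p1 (by linarith) h0 h1 (by linarith) (by linarith)
    have e2 := int_flip p2 (by linarith) h1 h2 (by linarith) (by linarith)
    have e3 := int_flip (p2.trans p1) (by linarith) h0 h2 (by linarith) (by linarith)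
    omega

lemma sin_ge {δ x : ℝ} (hδ : 0 ≤ δ) (h1 : Real.pi * δ / 2 ≤ x) (h2 : x ≤ Real.pi - Real.pi * δ / 2) : δ ≤ |Real.sin x| := by
  have hp := Real.pi_pos
  have core : ∀ y, Real.pi * δ / 2 ≤ y → y ≤ Real.pi / 2 → δ ≤ Real.sin y := by
    intro y a b
    have := Real.mul_le_sin (x := y) (le_trans (by positivity) a) b
    refine le_trans ?_ this
    rw [div_mul_eq_mul_div, le_div_iff₀ hp]; linarith
  refine le_trans ?_ (le_abs_self _)
  rcases le_total x (Real.pi / 2) with h | h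
  · exact core x h1 h
  · rw [← Real.sin_pi_sub]; exact core _ (by linarith) (by linarith)

noncomputable def pt (k a b : ℕ) : Fin 3 → ℝ :=
  ![Real.pi / k * ((2 * a + b) / 3), Real.pi / k * ((b - a) / 3), - (Real.pi / k * ((a + 2 * b) / 3))]

lemma pt_HH (k a b : ℕ) : pt k a b ∈ HH := by
  change pt k a b 0 + pt k a b 1 + pt k a b 2 = 0
  simp [pt]; ring

lemma pt01 (k a b : ℕ) : pt k a b 0 - pt k a b 1 = Real.pi / k * a := by simp [pt]; ring
lemma pt12 (k a b : ℕ) : pt k a b 1 - pt k a b 2 = Real.pi / k * b := by simp [pt]; ring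
lemma pt02 (k a b : ℕ) : pt k a b 0 - pt k a b 2 = Real.pi / k * (a + b) := by simp [pt]; ring

lemma pt_cos {k a b : ℕ} (hk : 1 ≤ k) (h : a % 3 ≠ b % 3) (j : Fin 3) : Real.cos (2 * k * pt k a b j) = - (1 / 2) := by
  have k0 : (k:ℝ) ≠ 0 := by positivity
  have T : ∀ (t : ℝ) (c : ℤ), c % 3 ≠ 0 → 2 * k * t = 2 * Real.pi * (c / 3) → Real.cos (2 * k * t) = - (1 / 2) := by
    intro t c hc ht
    rw [ht, cos_third c hc]
  fin_cases j
  · refine T _ (2 * a + b) (by omega) ?_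
    simp [pt]; field_simp
  · refine T _ (b - a) (by omega) ?_
    simp [pt]; field_simp
  · refine T _ (-(a + 2 * b)) (by omega) ?_
    simp [pt]; field_simp; ring

lemma pt_node {k a b : ℕ} (hk : 1 ≤ k) : Node k (pt k a b) := by
  have k0 : (k:ℝ) ≠ 0 := by positivity
  refine ⟨pt_HH k a b, ?_, ?_⟩
  · rw [← ex_nat, ← ex_nat, ex_eq_iff]
    refine ⟨-(a:ℤ), ?_⟩
    have := pt01 k a b
    rw [show pt k a b 1 = pt k a b 0 - Real.pi / k * a by linarith]
    push_cast; field_simp; ring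
  · rw [← ex_nat, ← ex_nat, ex_eq_iff]
    refine ⟨-((a:ℤ) + b), ?_⟩
    have := pt02 k a b
    rw [show pt k a b 2 = pt k a b 0 - Real.pi / k * (a + b) by linarith]
    push_cast; field_simp; ring

lemma count_exists (n G k : ℕ) (h : 3 * G + 3 * n + 3 ≤ 2 * k) : ∃ g : Fin (3 * n ^ 2) → ℕ × ℕ, Function.Injective g ∧
    ∀ i, G ≤ (g i).1 ∧ G ≤ (g i).2 ∧ (g i).1 + (g i).2 + G ≤ 2 * k ∧ (g i).1 % 3 ≠ (g i).2 % 3 := by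
  have e : Fin (3 * n ^ 2) ≃ Fin n × Fin n × Fin 3 := (Fintype.equivFinOfCardEq (by simp; ring)).symm
  let f : Fin n × Fin n × Fin 3 → ℕ × ℕ := fun x =>
    if x.1.1 + x.2.1.1 < n then (G + 3 * x.1.1 + x.2.2.1, G + x.2.2.1 + 1 + 3 * x.2.1.1)
    else (G + 3 * (n - 1 - x.1.1) + x.2.2.1, G + x.2.2.1 + 2 + 3 * (n - 1 - x.2.1.1))
  have hf : Function.Injective f := by
    rintro ⟨⟨a, ha⟩, ⟨b, hb⟩, ⟨c, hc⟩⟩ ⟨⟨a', ha'⟩, ⟨b', hb'⟩, ⟨c', hc'⟩⟩ h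
    simp only [f] at h
    simp only [Prod.mk.injEq, Fin.mk.injEq]
    split_ifs at h <;> simp only [Prod.mk.injEq] at h <;> omega
  refine ⟨f ∘ e, hf.comp e.injective, fun i => ?_⟩
  simp only [Function.comp]
  generalize e i = x
  obtain ⟨⟨a, ha⟩, ⟨b, hb⟩, ⟨c, hc⟩⟩ := x
  simp only [f]
  split_ifs <;> simp only [] <;> refine ⟨?_, ?_, ?_, ?_⟩ <;> omega

set_option maxHeartbeats 2000000 in
theorem constr2 (K k m n G : ℕ) (δ ρ : ℝ) (hk : 1 ≤ k) (hkK : k ≤ K)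
    (hdeg : 4 * m + 2 * k ≤ 2 * K - 1) (hδ : 0 < δ) (hδ1 : δ ≤ 1) (hρ : 0 < ρ) (hρδ : ρ ≤ δ)
    (hGδ : 2 * k * δ ≤ G) (hn : 3 * G + 3 * n + 3 ≤ 2 * k) (N : ℕ) (hN : N = 3 * n ^ 2)
    (hρ1 : N * (24 * k * ρ) ≤ 1 / 50) (hρ2 : 2 * k * ρ ≤ 1 / 4) (q : ℝ) (hq : q = (1 - δ ^ 6 / 2) ^ m)
    (hG : N * (42 * q * 6) < (2 * k * ρ) ^ 2 / 400)
    (hout : 2 + N * (42 * q * 6) < (1 + δ ^ 6 / 2) ^ m / 5)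
    (hsec : 21 * q * (480 * m + 2 * K) ^ 2 + N * (42 * q * (6 * (4 * k) ^ 2)) < (k : ℝ) ^ 2 / 4) :
    ∃ P : MvPolynomial (Fin 3) ℝ, P ≠ 0 ∧ P.IsHomogeneous (2 * K) ∧
      Squarefree (MvPolynomial.map (algebraMap ℝ ℂ) P) ∧ (RZ P).Finite ∧ (RZ P).ncard = N := by
  subst hN
  obtain ⟨g, ginj, hg⟩ := count_exists n G k hn
  have k0 : (0:ℝ) < k := by positivity
  have hp := Real.pi_gt_three
  have pk : 0 < Real.pi / k := by positivity
  have G0 : 0 < (G:ℝ) := lt_of_lt_of_le (by positivity) hGδ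
  have pG : 2 * (Real.pi * δ) ≤ Real.pi / k * G := by
    have : Real.pi / k * (2 * k * δ) ≤ Real.pi / k * G := by gcongr
    refine le_trans (le_of_eq ?_) this
    field_simp
  have pδ : ρ ≤ Real.pi * δ / 2 := by nlinarith
  have A : ∀ i, Real.pi / k * G ≤ Real.pi / k * (g i).1 := fun i => by
    have : (G:ℝ) ≤ (g i).1 := by exact_mod_cast (hg i).1
    gcongr
  have B : ∀ i, Real.pi / k * G ≤ Real.pi / k * (g i).2 := fun i => by
    have : (G:ℝ) ≤ (g i).2 := by exact_mod_cast (hg i).2.1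
    gcongr
  have C : ∀ i, Real.pi / k * ((g i).1 + (g i).2) ≤ 2 * Real.pi - Real.pi / k * G := fun i => by
    have h1 : ((g i).1 : ℝ) + (g i).2 + G ≤ 2 * k := by exact_mod_cast (hg i).2.2.1
    have : Real.pi / k * (((g i).1 : ℝ) + (g i).2 + G) ≤ Real.pi / k * (2 * k) := by gcongr
    have e : Real.pi / k * (2 * k) = 2 * Real.pi := by field_simp
    linarith
  have d1 := fun i => pt01 k (g i).1 (g i).2
  have d2 := fun i => pt12 k (g i).1 (g i).2
  have d3 := fun i => pt02 k (g i).1 (g i).2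
  have pd : 0 < Real.pi * δ := by positivity
  refine main_constr K k m (3 * n ^ 2) δ ρ (fun i => pt k (g i).1 (g i).2) hk hkK hdeg hδ hδ1 hρ
    (fun i => pt_node hk) (fun i j => pt_cos hk (hg i).2.2.2 j) ?_ ?_ ?_ hρ1 hρ2 q hq hG hout hsec
  · intro i j hij h
    apply hij
    apply ginj
    have := A i; have := B i; have := C i; have := d1 i; have := d2 i; have := d3 i
    have := A j; have := B j; have := C j; have := d1 j; have := d2 j; have := d3 j
    obtain ⟨e0, e1, e2⟩ := alcove (pt_HH _ _ _) (pt_HH _ _ _) h (by linarith) (by linarith) (by linarith) (by linarith)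
      (by linarith) (by linarith)
    have f1 : Real.pi / k * (g i).1 = Real.pi / k * (g j).1 := by linarith
    have f2 : Real.pi / k * (g i).2 = Real.pi / k * (g j).2 := by linarith
    have f1 := mul_left_cancel₀ pk.ne' f1
    have f2 := mul_left_cancel₀ pk.ne' f2
    exact Prod.ext (by exact_mod_cast f1) (by exact_mod_cast f2)
  · intro i
    have := A i; have := B i; have := C i; have := d1 i; have := d2 i; have := d3 i
    have T : ∀ x y : ℝ, 0 < x - y → x - y < 2 * Real.pi → ex x ≠ ex y := by
      intro x y h1 h2 h
      obtain ⟨n, hn⟩ := (ex_eq_iff _ _).1 h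
      have l1 : (0:ℝ) < n := by
        by_contra hc
        push Not at hc
        nlinarith
      have l2 : (n:ℝ) < 1 := by
        by_contra hc
        push Not at hc
        nlinarith
      have l1 : 0 < n := by exact_mod_cast l1
      have l2 : n < 1 := by exact_mod_cast l2
      omega
    exact ⟨T _ _ (by linarith) (by linarith), T _ _ (by linarith) (by linarith), T _ _ (by linarith) (by linarith)⟩
  · intro i θ hθ hd
    have := A i; have := B i; have := C i; have := d1 i; have := d2 i; have := d3 i
    have t : ∀ j, |θ j - pt k (g i).1 (g i).2 j| ≤ ρ := fun j => (norm_le_pi_norm (θ - pt k (g i).1 (g i).2) j).trans hd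
    have a0 := abs_le.1 (t 0)
    have a1 := abs_le.1 (t 1)
    have a2 := abs_le.1 (t 2)
    refine ⟨hθ, sin_ge hδ.le (by linarith) (by linarith), sin_ge hδ.le (by linarith) (by linarith), ?_⟩
    rw [show (θ 2 - θ 0) / 2 = - ((θ 0 - θ 2) / 2) by ring, Real.sin_neg, abs_neg]
    exact sin_ge hδ.le (by linarith) (by linarith)


def Good (K : ℕ) (P : MvPolynomial (Fin 3) ℝ) : Prop :=
  P ≠ 0 ∧ P.IsHomogeneous (2 * K) ∧ Squarefree (MvPolynomial.map (algebraMap ℝ ℂ) P) ∧ (RZ P).Finite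

lemma good_exists (K : ℕ) (hK : 1 ≤ K) : ∃ P, Good K P := by
  have hE : ∀ z, 0 ≤ Efun K z := fun z => Finset.prod_nonneg fun j _ => by positivity
  obtain ⟨P, h1, h2, h3, h4, -⟩ := poly_final K hK (fun _ => 1) (PF.const _ 1) 1 one_pos (by
    have : {z : ℂ | 1 + 1 * Efun K z = 0} = ∅ := by
      ext z
      simp only [Set.mem_ofPred_eq, Set.mem_empty_iff_false, iff_false]
      have := hE z
      linarith
    rw [this]; exact Set.finite_empty)
  exact ⟨P, h1, h2, h3, h4⟩

/-- The numeric verification of the parameter constraints. -/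
lemma constr3 (K m n : ℕ) (δ : ℝ) (hδ : 0 < δ) (hδ1 : δ ≤ 1 / 20) (hm : (m : ℝ) ≤ δ * K)
    (hn : (n : ℝ) ≤ 2 / 3 * (1 - 10 * δ) * K) (hK1 : 20 ≤ δ * K)
    (hq : (1 - δ ^ 6 / 2) ^ m * (K : ℝ) ^ 6 < 1 / 10 ^ 13) (hb : 15 < (1 + δ ^ 6 / 2) ^ m) :
    ∃ P, Good K P ∧ (RZ P).ncard = 3 * n ^ 2 := by
  have K0' : (0:ℝ) ≤ K := by positivity
  have hK : (400:ℝ) ≤ K := by nlinarith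
  have hmK : (m:ℝ) ≤ K / 20 := by nlinarith
  have h2m : 2 * m + 1 ≤ K := by
    have : (2 * m + 1 : ℝ) ≤ K := by linarith
    exact_mod_cast this
  obtain ⟨k, hk⟩ := Nat.exists_eq_add_of_le h2m
  have hkr : (k:ℝ) = K - 2 * m - 1 := by rw [hk]; push_cast; ring
  have kK : (k:ℝ) ≤ K := by have : (0:ℝ) ≤ m := by positivity
                            linarith
  have kK2 : (K:ℝ) / 2 ≤ k := by linarith
  set G := ⌈2 * k * δ⌉₊ with hGd
  have hG1 : 2 * k * δ ≤ G := Nat.le_ceil _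
  have hG2 : (G:ℝ) < 2 * k * δ + 1 := Nat.ceil_lt_add_one (by positivity)
  have hkδ : k * δ ≤ δ * K := by nlinarith
  have hnG : 3 * G + 3 * n + 3 ≤ 2 * k := by
    have : (3 * G + 3 * n + 3 : ℝ) ≤ 2 * k := by linarith
    exact_mod_cast this
  have Kp : (0:ℝ) < K := by linarith
  have hd6 : δ ^ 6 ≤ 1 := pow_le_one₀ hδ.le (by linarith)
  set q := (1 - δ ^ 6 / 2) ^ m with hqd
  have q0 : 0 ≤ q := pow_nonneg (by linarith) _
  have n1 : (n:ℝ) ≤ 2 / 3 * K := by nlinarith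
  have hN : ((3 * n ^ 2 : ℕ) : ℝ) ≤ 2 * K ^ 2 := by
    push_cast
    have : (n:ℝ) ^ 2 ≤ (2 / 3 * K) ^ 2 := by gcongr
    nlinarith
  set ρ : ℝ := 1 / (2500 * K ^ 3) with hρd
  have hρK : ρ * K ^ 3 = 1 / 2500 := by rw [hρd]; field_simp
  have ρ0 : 0 < ρ := by positivity
  have K1 : (1:ℝ) ≤ K := by linarith
  have hq2 : q * K ^ 2 ≤ 1 / 10 ^ 13 := by
    refine le_trans ?_ hq.le
    exact mul_le_mul_of_nonneg_left (pow_le_pow_right₀ K1 (by norm_num)) q0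
  have hq4 : q * K ^ 4 ≤ 1 / 10 ^ 13 := by
    refine le_trans ?_ hq.le
    exact mul_le_mul_of_nonneg_left (pow_le_pow_right₀ K1 (by norm_num)) q0
  have NQ : ((3 * n ^ 2 : ℕ) : ℝ) * (42 * q * 6) ≤ 504 * (q * K ^ 2) := by
    calc _ ≤ 2 * (K:ℝ) ^ 2 * (42 * q * 6) := by gcongr
      _ = _ := by ring
  obtain ⟨P, h1, h2, h3, h4, h5⟩ := constr2 K k m n G δ ρ (by
      have : (1:ℝ) ≤ k := by linarith
      exact_mod_cast this) (by exact_mod_cast kK) (by omega) hδ (by linarith) ρ0 (by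
      rw [hρd, div_le_iff₀ (by positivity)]
      have : (1:ℝ) ≤ K ^ 2 := one_le_pow₀ K1
      nlinarith [mul_le_mul hK1 this (by norm_num) (by positivity)]) hG1 hnG _ rfl
      (by
        calc _ ≤ 2 * (K:ℝ) ^ 2 * (24 * K * ρ) := by gcongr
          _ = 48 * (ρ * K ^ 3) := by ring
          _ ≤ _ := by rw [hρK]; norm_num)
      (by
        calc _ ≤ 2 * (K:ℝ) * ρ := by gcongr
          _ ≤ 2 * (ρ * K ^ 3) := by
            have : (K:ℝ) ≤ K ^ 3 := le_self_pow₀ K1 (by norm_num)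
            nlinarith
          _ ≤ _ := by rw [hρK]; norm_num)
      q hqd
      (by
        have a1 : (K * ρ) ^ 2 / 400 ≤ (2 * k * ρ) ^ 2 / 400 := by
          have : K * ρ ≤ 2 * k * ρ := by gcongr; linarith
          gcongr
        refine lt_of_lt_of_le ?_ a1
        refine lt_of_le_of_lt NQ ?_
        have : 0 < (K:ℝ) ^ 4 := by positivity
        refine lt_of_mul_lt_mul_right ?_ this.le
        rw [show (K * ρ) ^ 2 / 400 * (K:ℝ) ^ 4 = (ρ * K ^ 3) ^ 2 / 400 by ring, hρK,
          show 504 * (q * (K:ℝ) ^ 2) * K ^ 4 = 504 * (q * K ^ 6) by ring]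
        norm_num at hq ⊢
        linarith)
      (by
        norm_num at hq2
        linarith)
      (by
        have b1 : 21 * q * (480 * m + 2 * K) ^ 2 ≤ 21 * q * (26 * K) ^ 2 := by gcongr; linarith
        have b2 : ((3 * n ^ 2 : ℕ) : ℝ) * (42 * q * (6 * (4 * k) ^ 2)) ≤ 2 * (K:ℝ) ^ 2 * (42 * q * (6 * (4 * K) ^ 2)) := by
          gcongr
        have b3 : ((K:ℝ) / 2) ^ 2 / 4 ≤ (k:ℝ) ^ 2 / 4 := by gcongr
        have e1 : 21 * q * (26 * (K:ℝ)) ^ 2 = 14196 * (q * K ^ 2) := by ring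
        have e2 : 2 * (K:ℝ) ^ 2 * (42 * q * (6 * (4 * K) ^ 2)) = 8064 * (q * K ^ 4) := by ring
        have e3 : ((K:ℝ) / 2) ^ 2 / 4 = K ^ 2 / 16 := by ring
        have e4 : (1:ℝ) ≤ K ^ 2 := one_le_pow₀ K1
        rw [e1] at b1
        rw [e2] at b2
        rw [e3] at b3
        norm_num at hq2 hq4
        linarith)
  exact ⟨P, ⟨h1, h2, h3, h4⟩, h5⟩

lemma approx (ε : ℝ) (hε : 0 < ε) : ∀ᶠ K : ℕ in atTop, ∃ P, Good K P ∧
    |((RZ P).ncard : ℝ) / (K : ℝ) ^ 2 - 4 / 3| < ε := by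
  obtain ⟨δ, hδ, hδ1, hδε⟩ : ∃ δ : ℝ, 0 < δ ∧ δ ≤ 1 / 20 ∧ δ ≤ ε / 30 :=
    ⟨min (1 / 20) (ε / 30), by positivity, min_le_left _ _, min_le_right _ _⟩
  have hd60 : 0 < δ ^ 6 := by positivity
  have hd6 : δ ^ 6 ≤ 1 := pow_le_one₀ hδ.le (by linarith)
  have tK : Tendsto (fun K : ℕ => δ * (K:ℝ)) atTop atTop :=
    Tendsto.const_mul_atTop hδ tendsto_natCast_atTop_atTop
  have tm : Tendsto (fun K : ℕ => ⌊δ * (K:ℝ)⌋₊) atTop atTop := tendsto_nat_floor_atTop.comp tK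
  have t1 := (tendsto_pow_const_mul_const_pow_of_lt_one 6 (r := 1 - δ ^ 6 / 2) (by linarith) (by linarith)).comp tm
  have t2 := (tendsto_pow_atTop_atTop_of_one_lt (r := 1 + δ ^ 6 / 2) (by linarith)).comp tm
  have ta : (0:ℝ) ≤ 2 / 3 * (1 - 10 * δ) := by nlinarith
  have t3 := (tendsto_nat_floor_mul_div_atTop ta).comp (tendsto_natCast_atTop_atTop (R := ℝ))
  have t4 := ((t3.pow 2).const_mul 3).sub_const (4 / 3)
  have lim : |3 * (2 / 3 * (1 - 10 * δ)) ^ 2 - 4 / 3| < ε := by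
    rw [abs_lt]; constructor <;> nlinarith
  have t5 := (t4.abs).eventually (gt_mem_nhds lim)
  have hc : (0:ℝ) < 1 / 10 ^ 13 * (δ / 2) ^ 6 := by positivity
  filter_upwards [t5, t1.eventually (gt_mem_nhds hc), t2.eventually_gt_atTop 15, tK.eventually_ge_atTop 20,
    tm.eventually_ge_atTop 1] with K h5 h1 h2 h3 hm1
  simp only [Function.comp] at h1 h2 h5
  set m := ⌊δ * (K:ℝ)⌋₊ with hm
  set n := ⌊2 / 3 * (1 - 10 * δ) * (K:ℝ)⌋₊ with hn
  have hmr : (1:ℝ) ≤ m := by exact_mod_cast hm1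
  have hlt : δ * K < m + 1 := Nat.lt_floor_add_one _
  have hKm : (K:ℝ) * (δ / 2) ≤ m := by nlinarith
  obtain ⟨P, hP, hc⟩ := constr3 K m n δ hδ hδ1 (Nat.floor_le (by positivity)) (Nat.floor_le (by positivity)) h3 (by
    have q0 : 0 ≤ (1 - δ ^ 6 / 2) ^ m := pow_nonneg (by linarith) _
    have : ((K:ℝ) * (δ / 2)) ^ 6 ≤ (m:ℝ) ^ 6 := by gcongr
    have h6 : (0:ℝ) < (δ / 2) ^ 6 := by positivity
    refine lt_of_mul_lt_mul_right ?_ h6.le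
    refine lt_of_le_of_lt ?_ h1
    calc _ = ((K:ℝ) * (δ / 2)) ^ 6 * (1 - δ ^ 6 / 2) ^ m := by ring
      _ ≤ _ := by gcongr) h2
  refine ⟨P, hP, ?_⟩
  rw [hc]
  have e : ((3 * n ^ 2 : ℕ) : ℝ) / (K : ℝ) ^ 2 = 3 * ((n : ℝ) / K) ^ 2 := by
    push_cast; rw [div_pow]; ring
  rw [e]
  exact h5

theorem stmt_4 :
    ∃ P : ℕ → MvPolynomial (Fin 3) ℝ,
      (∀ k : ℕ, 1 ≤ k → (P k ≠ 0 ∧ (P k).IsHomogeneous (2 * k) ∧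
        Squarefree (MvPolynomial.map (algebraMap ℝ ℂ) (P k)) ∧
        (RZ (P k)).Finite)) ∧
      Tendsto (fun k : ℕ => ((RZ (P k)).ncard : ℝ) / (k : ℝ) ^ 2) atTop
        (nhds (4 / 3)) := by
  classical
  have hex : ∀ K : ℕ, ∃ P, 1 ≤ K → (Good K P ∧ ∀ P', Good K P' →
      |((RZ P).ncard : ℝ) / (K : ℝ) ^ 2 - 4 / 3| < |((RZ P').ncard : ℝ) / (K : ℝ) ^ 2 - 4 / 3| + 1 / ((K : ℝ) + 1)) := by
    intro K
    by_cases hK : 1 ≤ K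
    · let S : Set ℝ := {r | ∃ P, Good K P ∧ |((RZ P).ncard : ℝ) / (K : ℝ) ^ 2 - 4 / 3| = r}
      have hS : S.Nonempty := by
        obtain ⟨P, hP⟩ := good_exists K hK
        exact ⟨_, P, hP, rfl⟩
      have hbd : BddBelow S := ⟨0, by rintro r ⟨P, -, rfl⟩; exact abs_nonneg _⟩
      have hp : (0:ℝ) < 1 / ((K:ℝ) + 1) := by positivity
      obtain ⟨r, ⟨P, hP, rfl⟩, hr⟩ := exists_lt_of_csInf_lt hS (show sInf S < sInf S + 1 / ((K:ℝ) + 1) by linarith)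
      refine ⟨P, fun _ => ⟨hP, fun P' hP' => ?_⟩⟩
      have := csInf_le hbd (show |((RZ P').ncard : ℝ) / (K : ℝ) ^ 2 - 4 / 3| ∈ S from ⟨P', hP', rfl⟩)
      linarith
    · exact ⟨0, fun h => absurd h hK⟩
  choose P hP using hex
  refine ⟨P, fun k hk => (hP k hk).1, ?_⟩
  rw [Metric.tendsto_nhds]
  intro ε hε
  have t := (tendsto_one_div_add_atTop_nhds_zero_nat (𝕜 := ℝ)).eventually (gt_mem_nhds (half_pos hε))
  filter_upwards [approx (ε / 2) (half_pos hε), t, eventually_ge_atTop 1] with K h1 h2 h3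
  obtain ⟨P', hP', h4⟩ := h1
  have := (hP K h3).2 P' hP'
  rw [Real.dist_eq]
  linarith
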